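/- arXiv:1702.03340 — 2 statements merged into one kernel-verified Lean document; each statement's English description precedes it below -/
import Mathlib

section
/- Let n ≥ 3 and let Φ be a Banach–Minkowski norm on ℝⁿ with unit ball B = {u ∈ ℝⁿ : Φ(u) ≤ 1}. Let v₀, w₀ ∈ ℝⁿ be linearly independent and H = span{v₀, w₀}. Suppose there is ε > 0 such that for all linearly independent v, w ∈ ℝⁿ with ‖v − v₀‖ < ε and ‖w − w₀‖ < ε there exists a linear bijection A : H → span{v, w} with A(H ∩ B) = span{v, w} ∩ B. Then there exist a positive definite quadratic form Q on ℝⁿ and an open set W ⊆ ℝⁿ with H∖{0} ⊆ W such that Φ(u)² = Q(u) for all u ∈ W; in particular H ∩ B = {u ∈ H : Q(u) ≤ 1}, so the cross-section H ∩ B is an ellipse centered at 0 and B coincides with the ellipsoid {Q ≤ 1} in a neighborhood of H. -/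
noncomputable section

def IsBanachMinkowski {V : Type*} [NormedAddCommGroup V] [NormedSpace ℝ V] (Φ : V → ℝ) : Prop :=
  Φ 0 = 0 ∧
  (∀ v : V, v ≠ 0 → 0 < Φ v) ∧
  (∀ t : ℝ, 0 ≤ t → ∀ v : V, Φ (t • v) = t * Φ v) ∧
  (∀ v w : V, Φ (v + w) ≤ Φ v + Φ w) ∧
  ContDiffOn ℝ (⊤ : ℕ∞) Φ {(0 : V)}ᶜ ∧
  (∀ v : V, v ≠ 0 → ∀ w : V, w ≠ 0 →
    0 < iteratedFDeriv ℝ 2 (fun u => Φ u ^ 2) v ![w, w])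

open Set Filter Topology

theorem dens_lemma (ψ : ℝ × ℝ → ℝ) (hc : ContinuousOn (fderiv ℝ ψ) {0}ᶜ)
    (g : ℝ × ℝ → ℝ × ℝ) (hg : Continuous g) (l : ℝ × ℝ →L[ℝ] ℝ) (Y : ℝ × ℝ) (hY : l Y ≠ 0)
    (h : ∀ X, X ≠ 0 → l X * fderiv ℝ ψ X (g X) = 0) :
    ∀ X, X ≠ 0 → fderiv ℝ ψ X (g X) = 0 := by
  intro X hX
  by_cases hl : l X = 0
  · have hcX : ContinuousAt (fderiv ℝ ψ) X := hc.continuousAt (isOpen_compl_singleton.mem_nhds hX)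
    have h0 : ContinuousAt (fun s : ℝ => X + s • Y) 0 := by fun_prop
    have hX0 : X = (fun s : ℝ => X + s • Y) 0 := by simp
    have h1 : ContinuousAt (fun s : ℝ => fderiv ℝ ψ (X + s • Y) (g (X + s • Y))) 0 := by
      refine ContinuousAt.clm_apply ?_ ?_
      · exact ContinuousAt.comp_of_eq hcX h0 (by simp)
      · exact (hg.continuousAt).comp_of_eq h0 rfl
    have h2 : ∀ᶠ s in 𝓝[≠] (0:ℝ), fderiv ℝ ψ (X + s • Y) (g (X + s • Y)) = 0 := by
      have : ∀ᶠ s in 𝓝 (0:ℝ), X + s • Y ≠ 0 :=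
        h0.eventually_ne (by simpa using hX)
      filter_upwards [this.filter_mono nhdsWithin_le_nhds, self_mem_nhdsWithin] with s hs hs0
      have := h _ hs
      have hne : l (X + s • Y) ≠ 0 := by
        simp only [map_add, map_smul, hl, zero_add, smul_eq_mul]
        exact mul_ne_zero hs0 hY
      exact (mul_eq_zero.1 this).resolve_left hne
    have h3 := tendsto_nhds_unique (h1.tendsto.mono_left nhdsWithin_le_nhds)
      (tendsto_const_nhds.congr' (h2.mono fun s hs => hs.symm))
    simpa using h3
  · exact (mul_eq_zero.1 (h X hX)).resolve_left hl

theorem clm2_apply (N : ℝ × ℝ →L[ℝ] ℝ × ℝ) (X : ℝ × ℝ) :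
    N X = (X.1 * (N (1,0)).1 + X.2 * (N (0,1)).1, X.1 * (N (1,0)).2 + X.2 * (N (0,1)).2) := by
  have : X = X.1 • ((1:ℝ),(0:ℝ)) + X.2 • ((0:ℝ),(1:ℝ)) := by ext <;> simp
  conv_lhs => rw [this, map_add, map_smul, map_smul]
  ext <;> simp

theorem rot_lemma_A (ψ : ℝ × ℝ → ℝ) (hc : ContinuousOn (fderiv ℝ ψ) {0}ᶜ)
    (hpos : ∀ X, X ≠ 0 → 0 < ψ X) (heul : ∀ X, X ≠ 0 → fderiv ℝ ψ X X = ψ X)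
    (N : ℝ × ℝ →L[ℝ] ℝ × ℝ) (hN : N ≠ 0) (h : ∀ X, X ≠ 0 → fderiv ℝ ψ X (N X) = 0)
    (X : ℝ × ℝ) (hX : X ≠ 0) : X.1 * (N X).2 - X.2 * (N X).1 ≠ 0 := by
  intro hq
  have hr : 0 < X.1 ^ 2 + X.2 ^ 2 := by
    rcases not_and_or.1 (fun h : X.1 = 0 ∧ X.2 = 0 => hX (Prod.ext h.1 h.2)) with h | h <;> positivity
  -- N X = μ X
  set r := X.1 ^ 2 + X.2 ^ 2 with hrdef
  set μ := (X.1 * (N X).1 + X.2 * (N X).2) / r with hμ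
  have hNX : N X = μ • X := by
    ext
    · simp only [Prod.smul_fst, smul_eq_mul, hμ]
      field_simp
      rw [hrdef]; linear_combination (- X.2) * hq
    · simp only [Prod.smul_snd, smul_eq_mul, hμ]
      field_simp
      rw [hrdef]; linear_combination (X.1) * hq
  have hμ0 : μ = 0 := by
    have := h X hX
    rw [hNX, map_smul, heul X hX, smul_eq_mul] at this
    exact (mul_eq_zero.1 this).resolve_right (hpos X hX).ne'
  have hNX0 : N X = 0 := by rw [hNX, hμ0, zero_smul]
  set X' : ℝ × ℝ := (-X.2, X.1) with hX'
  set b := N X' with hb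
  let l : ℝ × ℝ →L[ℝ] ℝ := X.1 • ContinuousLinearMap.snd ℝ ℝ ℝ - X.2 • ContinuousLinearMap.fst ℝ ℝ ℝ
  have hl : ∀ Z, l Z = X.1 * Z.2 - X.2 * Z.1 := fun Z => by simp [l]
  have hZ : ∀ Z : ℝ × ℝ, r • N Z = l Z • b := by
    intro Z
    have : r • Z = (X.1 * Z.1 + X.2 * Z.2) • X + l Z • X' := by
      rw [hl]
      ext <;> simp [hX', hrdef] <;> ring
    rw [← map_smul, this, map_add, map_smul, hNX0, map_smul, smul_zero, zero_add]
  have hb0 : b ≠ 0 := by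
    intro hb0
    apply hN
    refine ContinuousLinearMap.ext fun Z => ?_
    have := hZ Z
    rw [hb0, smul_zero] at this
    simpa using (smul_eq_zero.1 this).resolve_left hr.ne'
  have := dens_lemma ψ hc (fun _ => b) continuous_const l X' (by
    rw [hl]; simp [hX']; nlinarith) (by
    intro Z hZ0
    have h1 := h Z hZ0
    have h2 : fderiv ℝ ψ Z (r • N Z) = 0 := by rw [map_smul, h1, smul_zero]
    rw [hZ, map_smul] at h2
    simpa using h2) b hb0
  rw [heul b hb0] at this
  exact (hpos b hb0).ne' this

theorem conn2 : IsConnected ({0}ᶜ : Set (ℝ × ℝ)) :=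
  isConnected_compl_singleton_of_one_lt_rank (by
    rw [rank_prod', Module.rank_self]; exact_mod_cast (by norm_num : 1 < 1 + 1)) 0

theorem rot_lemma (ψ : ℝ × ℝ → ℝ) (hc : ContinuousOn (fderiv ℝ ψ) {0}ᶜ)
    (hd : ∀ X, X ≠ 0 → DifferentiableAt ℝ ψ X)
    (h0 : ψ 0 = 0) (hhom : ∀ t : ℝ, 0 ≤ t → ∀ X, ψ (t • X) = t * ψ X)
    (hpos : ∀ X, X ≠ 0 → 0 < ψ X) (heul : ∀ X, X ≠ 0 → fderiv ℝ ψ X X = ψ X)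
    (N : ℝ × ℝ →L[ℝ] ℝ × ℝ) (hN : N ≠ 0) (h : ∀ X, X ≠ 0 → fderiv ℝ ψ X (N X) = 0) :
    ∃ α β γ : ℝ, ∀ X, ψ X ^ 2 = α * X.1 ^ 2 + β * X.1 * X.2 + γ * X.2 ^ 2 := by
  have hA := rot_lemma_A ψ hc hpos heul N hN h
  set a := (N (1,0)).1 with ha
  set b := (N (0,1)).1 with hb
  set c := (N (1,0)).2 with hcc
  set d := (N (0,1)).2 with hdd
  have hNX : ∀ X, N X = (X.1 * a + X.2 * b, X.1 * c + X.2 * d) := clm2_apply N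
  set q : ℝ × ℝ → ℝ := fun X => c * X.1 ^ 2 + (d - a) * X.1 * X.2 - b * X.2 ^ 2 with hqdef
  have hq0 : ∀ X, X ≠ 0 → q X ≠ 0 := by
    intro X hX
    have := hA X hX
    rw [hNX] at this
    convert this using 1
    simp only [hqdef]; ring
  let q' : ℝ × ℝ → (ℝ × ℝ →L[ℝ] ℝ) := fun X =>
    (2 * c * X.1 + (d - a) * X.2) • ContinuousLinearMap.fst ℝ ℝ ℝ +
    ((d - a) * X.1 - 2 * b * X.2) • ContinuousLinearMap.snd ℝ ℝ ℝ
  have hq' : ∀ X, HasFDerivAt q (q' X) X := by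
    intro X
    have h1 : HasFDerivAt (fun X : ℝ × ℝ => X.1) (ContinuousLinearMap.fst ℝ ℝ ℝ) X := hasFDerivAt_fst
    have h2 : HasFDerivAt (fun X : ℝ × ℝ => X.2) (ContinuousLinearMap.snd ℝ ℝ ℝ) X := hasFDerivAt_snd
    have := (((h1.pow 2).const_mul c).add (((h1.const_mul (d - a)).mul h2))).sub ((h2.pow 2).const_mul b)
    refine this.congr_fderiv ?_
    ext <;> simp [q'] <;> ring
  have hqX : ∀ X, q' X X = 2 * q X := by
    intro X; simp [q', hqdef]; ring
  have hqN : ∀ X, q' X (N X) = (a + d) * q X := by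
    intro X; rw [hNX]; simp [q', hqdef]; ring
  have hqs : ∀ (t : ℝ) X, q (t • X) = t ^ 2 * q X := by
    intro t X; simp [hqdef]; ring
  -- maximum
  obtain ⟨X0, hX0, hmax⟩ : ∃ X0 ∈ Metric.sphere (0 : ℝ × ℝ) 1,
      IsMaxOn (fun X => q X / ψ X ^ 2) (Metric.sphere (0 : ℝ × ℝ) 1) X0 := by
    refine (isCompact_sphere _ _).exists_isMaxOn ⟨(1,0), by simp [Prod.norm_def]⟩ ?_
    intro X hX
    have hX : X ≠ 0 := by rintro rfl; simp at hX
    exact (((hq' X).continuousAt).div ((hd X hX).continuousAt.pow 2)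
      (pow_ne_zero 2 (hpos X hX).ne')).continuousWithinAt
  have hX0' : X0 ≠ 0 := by rintro rfl; simp at hX0
  set m := q X0 / ψ X0 ^ 2 with hm
  have hle : ∀ X, q X - m * ψ X ^ 2 ≤ 0 := by
    intro X
    by_cases hX : X = 0
    · subst hX; simp [h0, hqdef]
    · have hn : 0 < ‖X‖ := norm_pos_iff.2 hX
      set Y := ‖X‖⁻¹ • X with hY
      have hYs : Y ∈ Metric.sphere (0 : ℝ × ℝ) 1 := by
        simp [hY, norm_smul, hn.ne']
      have hY0 : Y ≠ 0 := by rintro h; rw [h] at hYs; simp at hYs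
      have hXY : X = ‖X‖ • Y := by rw [hY, smul_smul, mul_inv_cancel₀ hn.ne', one_smul]
      have h1 := hmax hYs
      simp only [mem_ofPred_eq] at h1
      rw [div_le_iff₀ (pow_pos (hpos Y hY0) 2)] at h1
      rw [hXY, hqs, hhom _ hn.le]
      have : ‖X‖ ^ 2 * (q Y - m * ψ Y ^ 2) ≤ 0 :=
        mul_nonpos_of_nonneg_of_nonpos (by positivity) (by linarith)
      nlinarith
  have hloc : IsLocalMax (fun X => q X - m * ψ X ^ 2) X0 := by
    refine Filter.Eventually.of_forall fun X => ?_
    have : q X0 - m * ψ X0 ^ 2 = 0 := by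
      rw [hm, div_mul_cancel₀ _ (pow_ne_zero 2 (hpos X0 hX0').ne'), sub_self]
    simp only [this]
    exact hle X
  have hder := hloc.hasFDerivAt_eq_zero
    ((hq' X0).sub ((((hd X0 hX0').hasFDerivAt).pow 2).const_mul m))
  have htr : a + d = 0 := by
    have h1 := congrArg (fun L : ℝ × ℝ →L[ℝ] ℝ => L (N X0)) hder
    simp [h X0 hX0', hqN] at h1
    exact h1.resolve_right (hq0 X0 hX0')
  -- constant
  have hconst : ∀ X, X ≠ 0 → q X / ψ X ^ 2 = m := by
    intro X hX
    have key : ∀ X, X ≠ 0 → HasFDerivAt (fun X => q X / ψ X ^ 2) (0 : ℝ × ℝ →L[ℝ] ℝ) X := by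
      intro X hX
      have hψ2 : ψ X ^ 2 ≠ 0 := pow_ne_zero 2 (hpos X hX).ne'
      have hd0 : HasFDerivAt (fun X => (ψ X ^ 2)⁻¹) _ X :=
        (hasDerivAt_inv hψ2).comp_hasFDerivAt X (((hd X hX).hasFDerivAt).pow 2)
      have hd1 := (hq' X).mul hd0
      simp only [div_eq_mul_inv]
      refine hd1.congr_fderiv ?_
      set G := q X • -((ψ X ^ 2) ^ 2)⁻¹ • (2 • ψ X ^ (2-1)) • fderiv ℝ ψ X + (ψ X ^ 2)⁻¹ • q' X with hG
      have e1 : G X = 0 := by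
        have := (hpos X hX).ne'
        simp [hG, hqX, heul X hX]; field_simp; ring
      have e2 : G (N X) = 0 := by
        simp [hG, hqN, htr, h X hX]
      have e3 : ∀ Z, q X • Z = (Z.1 * (N X).2 - Z.2 * (N X).1) • X + (X.1 * Z.2 - X.2 * Z.1) • N X := by
        intro Z
        rw [hNX]
        ext <;> simp [hqdef] <;> ring
      have e4 : G = 0 := by
        refine ContinuousLinearMap.ext fun Z => ?_
        have := congrArg G (e3 Z)
        simp only [map_add, map_smul, e1, e2, smul_zero, add_zero] at this
        simpa using (smul_eq_zero.1 this).resolve_left (hq0 X hX)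
      exact e4
    exact isOpen_compl_singleton.is_const_of_fderiv_eq_zero conn2.isPreconnected
      (fun X hX => (key X hX).differentiableAt.differentiableWithinAt)
      (fun X hX => (key X hX).fderiv) hX hX0'
  have hm0 : m ≠ 0 := by
    rw [hm]; exact div_ne_zero (hq0 _ hX0') (pow_ne_zero 2 (hpos X0 hX0').ne')
  refine ⟨c / m, (d - a) / m, - b / m, fun X => ?_⟩
  by_cases hX : X = 0
  · subst hX; simp [h0]
  · have := hconst X hX
    rw [div_eq_iff (pow_ne_zero 2 (hpos X hX).ne')] at this
    field_simp
    rw [mul_comm _ m, ← this]; simp only [hqdef]; ring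


theorem elim_lemma (ψ : ℝ × ℝ → ℝ) (hc : ContinuousOn (fderiv ℝ ψ) {0}ᶜ)
    (hpos : ∀ X, X ≠ 0 → 0 < ψ X) (heul : ∀ X, X ≠ 0 → fderiv ℝ ψ X X = ψ X)
    (hnd : ∀ N : ℝ × ℝ →L[ℝ] ℝ × ℝ, (∀ X, X ≠ 0 → fderiv ℝ ψ X (N X) = 0) → N = 0)
    (T1 T2 : ℝ × ℝ →L[ℝ] ℝ × ℝ) (f : ℝ × ℝ → ℝ)
    (h1 : ∀ X, X ≠ 0 → X.1 * f X = fderiv ℝ ψ X (T1 X))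
    (h2 : ∀ X, X ≠ 0 → X.2 * f X = fderiv ℝ ψ X (T2 X)) :
    ∃ c : ℝ × ℝ, ∀ X, X ≠ 0 → f X = fderiv ℝ ψ X c := by
  set V : ℝ × ℝ → ℝ × ℝ := fun X => X.2 • T1 X - X.1 • T2 X with hV
  have hVt : ∀ X, X ≠ 0 → fderiv ℝ ψ X (V X) = 0 := by
    intro X hX
    simp only [hV, map_sub, map_smul, ← h1 X hX, ← h2 X hX, smul_eq_mul]; ring
  have hVc : Continuous V := by fun_prop
  -- zero of the cubic form
  obtain ⟨X0, hX0, hc0⟩ : ∃ X0 ∈ ({0}ᶜ : Set (ℝ × ℝ)), X0.1 * (V X0).2 - X0.2 * (V X0).1 = 0 := by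
    set k : ℝ × ℝ → ℝ := fun X => X.1 * (V X).2 - X.2 * (V X).1 with hk
    have hkc : Continuous k := by fun_prop
    have hkodd : ∀ X, k (-X) = - k X := by
      intro X; simp [hk, hV]; ring
    have hm1 : ((1, 0) : ℝ × ℝ) ∈ ({0}ᶜ : Set (ℝ × ℝ)) := by simp
    have hm2 : (-(1, 0) : ℝ × ℝ) ∈ ({0}ᶜ : Set (ℝ × ℝ)) := by simp
    rcases le_total (k (1, 0)) 0 with h | h
    · exact conn2.isPreconnected.intermediate_value hm1 hm2 hkc.continuousOn
        ⟨h, by rw [hkodd]; linarith⟩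
    · exact conn2.isPreconnected.intermediate_value hm2 hm1 hkc.continuousOn
        ⟨by rw [hkodd]; linarith, h⟩
  have hX0 : X0 ≠ 0 := hX0
  have hr : 0 < X0.1 ^ 2 + X0.2 ^ 2 := by
    rcases not_and_or.1 (fun h : X0.1 = 0 ∧ X0.2 = 0 => hX0 (Prod.ext h.1 h.2)) with h | h <;> positivity
  have hV0 : V X0 = 0 := by
    set r := X0.1 ^ 2 + X0.2 ^ 2 with hrdef
    set μ := (X0.1 * (V X0).1 + X0.2 * (V X0).2) / r with hμ
    have hNX : V X0 = μ • X0 := by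
      ext
      · simp only [Prod.smul_fst, smul_eq_mul, hμ]
        field_simp
        rw [hrdef]; linear_combination (- X0.2) * hc0
      · simp only [Prod.smul_snd, smul_eq_mul, hμ]
        field_simp
        rw [hrdef]; linear_combination (X0.1) * hc0
    have := hVt X0 hX0
    rw [hNX, map_smul, heul X0 hX0, smul_eq_mul] at this
    rw [hNX, (mul_eq_zero.1 this).resolve_right (hpos X0 hX0).ne', zero_smul]
  -- factor V
  set p := X0.1
  set q := X0.2
  set Y : ℝ × ℝ := (-q, p) with hY
  set r := p ^ 2 + q ^ 2 with hrdef
  let m : ℝ × ℝ →L[ℝ] ℝ := p • ContinuousLinearMap.fst ℝ ℝ ℝ + q • ContinuousLinearMap.snd ℝ ℝ ℝ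
  let l : ℝ × ℝ →L[ℝ] ℝ := p • ContinuousLinearMap.snd ℝ ℝ ℝ - q • ContinuousLinearMap.fst ℝ ℝ ℝ
  have hm : ∀ X, m X = p * X.1 + q * X.2 := fun X => by simp [m]
  have hl : ∀ X, l X = p * X.2 - q * X.1 := fun X => by simp [l]
  let L : ℝ × ℝ →L[ℝ] ℝ × ℝ :=
    m.smulRight (q • T1 Y - p • T2 Y + p • T1 X0 + q • T2 X0) + l.smulRight (V Y)
  have hfac : ∀ X, r ^ 2 • V X = l X • L X := by
    intro X
    have hX : r • X = m X • X0 + l X • Y := by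
      rw [hm, hl]; ext <;> simp [hY, hrdef, p, q] <;> ring
    have e0 : r ^ 2 • V X = V (r • X) := by
      simp only [hV, map_smul]
      ext <;> simp <;> ring
    rw [e0, hX]
    have e1 : q • T1 X0 - p • T2 X0 = 0 := hV0
    have e2 : V (m X • X0 + l X • Y) = m X ^ 2 • (q • T1 X0 - p • T2 X0) + l X • L X := by
      have : L X = m X • (q • T1 Y - p • T2 Y + p • T1 X0 + q • T2 X0) + l X • V Y := by
        simp [L]
      rw [this]
      simp only [hV, map_add, map_smul]
      ext <;> simp [hY, p, q] <;> ring
    rw [e2, e1, smul_zero, zero_add]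
  have hL : L = 0 := by
    apply hnd
    apply dens_lemma ψ hc (fun X => L X) L.continuous l Y
    · rw [hl]; simp only [hY]; nlinarith
    · intro X hX
      have := hVt X hX
      have h3 : fderiv ℝ ψ X (r ^ 2 • V X) = 0 := by rw [map_smul, this, smul_zero]
      rw [hfac, map_smul, smul_eq_mul] at h3
      exact h3
  have hVz : ∀ X, V X = 0 := by
    intro X
    have := hfac X
    rw [hL] at this
    simp only [zero_apply, smul_zero] at this
    exact (smul_eq_zero.1 this).resolve_left (by positivity)
  have a1 : T2 (1, 0) = 0 := by simpa [hV] using hVz (1, 0)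
  have a2 : T1 (0, 1) = 0 := by simpa [hV] using hVz (0, 1)
  have a3 : T1 (1, 0) = T2 (0, 1) := by
    have := hVz (1, 1)
    have e : ((1, 1) : ℝ × ℝ) = (1, 0) + (0, 1) := by simp
    simp only [hV, one_smul] at this
    rw [e, map_add, map_add, a1, a2] at this
    simpa [sub_eq_zero] using this
  refine ⟨T1 (1, 0), fun X hX => ?_⟩
  have hXe : X = X.1 • ((1:ℝ),(0:ℝ)) + X.2 • ((0:ℝ),(1:ℝ)) := by ext <;> simp
  have b1 : T1 X = X.1 • T1 (1, 0) := by
    conv_lhs => rw [hXe, map_add, map_smul, map_smul, a2, smul_zero, add_zero]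
  have b2 : T2 X = X.2 • T1 (1, 0) := by
    conv_lhs => rw [hXe, map_add, map_smul, map_smul, a1, smul_zero, zero_add, ← a3]
  have c1 := h1 X hX
  have c2 := h2 X hX
  rw [b1, map_smul, smul_eq_mul] at c1
  rw [b2, map_smul, smul_eq_mul] at c2
  rcases not_and_or.1 (fun h : X.1 = 0 ∧ X.2 = 0 => hX (Prod.ext h.1 h.2)) with h | h
  · exact mul_left_cancel₀ h c1
  · exact mul_left_cancel₀ h c2

theorem limit_lemma {E : Type*} [NormedAddCommGroup E] [NormedSpace ℝ E]
    (Φ : E → ℝ) (hΦd : ∀ x, x ≠ 0 → DifferentiableAt ℝ Φ x)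
    (ι : ℝ × ℝ →L[ℝ] E) (hι : ∀ X, X ≠ 0 → ι X ≠ 0)
    (ψ : ℝ × ℝ → ℝ) (hψ : ∀ X, ψ X = Φ (ι X)) 
    (hΦc : Continuous Φ)
    (hhom : ∀ t : ℝ, 0 ≤ t → ∀ X, ψ (t • X) = t * ψ X)
    (hpos : ∀ X, X ≠ 0 → 0 < ψ X)
    (hnd : ∀ N : ℝ × ℝ →L[ℝ] ℝ × ℝ, (∀ X, X ≠ 0 → fderiv ℝ ψ X (N X) = 0) → N = 0)
    (e : E) (l : ℝ × ℝ →L[ℝ] ℝ) (t : ℕ → ℝ) (ht : ∀ k, 0 < t k) (ht0 : Tendsto t atTop (𝓝 0))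
    (M : ℕ → (ℝ × ℝ →L[ℝ] ℝ × ℝ)) 
    (hM : ∀ k X, Φ (ι X + t k • l X • e) = ψ (M k X)) :
    ∃ T : ℝ × ℝ →L[ℝ] ℝ × ℝ, ∀ X, X ≠ 0 → l X * fderiv ℝ Φ (ι X) e = fderiv ℝ ψ X (T X) := by
  have hψc : Continuous ψ := by
    have : ψ = fun X => Φ (ι X) := funext hψ
    rw [this]; fun_prop
  have hψd : ∀ X, X ≠ 0 → DifferentiableAt ℝ ψ X := by
    intro X hX
    have : ψ = fun X => Φ (ι X) := funext hψ
    rw [this]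
    exact (hΦd _ (hι X hX)).comp X ι.differentiableAt
  -- lower bound for ψ
  obtain ⟨m, hm, hmle⟩ : ∃ m : ℝ, 0 < m ∧ ∀ X, m * ‖X‖ ≤ ψ X := by
    obtain ⟨X0, hX0, hmin⟩ := (isCompact_sphere (0 : ℝ × ℝ) 1).exists_isMinOn
      ⟨(1,0), by simp [Prod.norm_def]⟩ hψc.continuousOn
    have hX0' : X0 ≠ 0 := by rintro rfl; simp at hX0
    refine ⟨ψ X0, hpos X0 hX0', fun X => ?_⟩
    by_cases hX : X = 0
    · subst hX
      have := hhom 0 le_rfl 0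
      simp at this
      simp [this]
    · have hn : 0 < ‖X‖ := norm_pos_iff.2 hX
      have hYs : ‖X‖⁻¹ • X ∈ Metric.sphere (0 : ℝ × ℝ) 1 := by
        simp [norm_smul, hn.ne']
      have h1 : ψ X0 ≤ ψ (‖X‖⁻¹ • X) := hmin hYs
      rw [hhom _ (by positivity)] at h1
      rw [mul_comm]
      calc ‖X‖ * ψ X0 ≤ ‖X‖ * (‖X‖⁻¹ * ψ X) := by gcongr
        _ = ψ X := by field_simp
  -- upper bound
  obtain ⟨t1, ht1⟩ : ∃ t1, ∀ k, t k ≤ t1 := by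
    obtain ⟨c, hc⟩ := ht0.bddAbove_range
    exact ⟨c, fun k => hc ⟨k, rfl⟩⟩
  obtain ⟨K, hK⟩ : ∃ K : ℝ, ∀ s ∈ Icc (0:ℝ) t1, ∀ X ∈ Metric.sphere (0 : ℝ × ℝ) 1,
      Φ (ι X + s • l X • e) ≤ K := by
    have hcont : Continuous (fun p : ℝ × (ℝ × ℝ) => Φ (ι p.2 + p.1 • l p.2 • e)) := by fun_prop
    obtain ⟨K, hK⟩ := ((isCompact_Icc (a := (0:ℝ)) (b := t1)).prod
      (isCompact_sphere (0 : ℝ × ℝ) 1)).bddAbove_image hcont.continuousOn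
    exact ⟨K, fun s hs X hX => hK ⟨(s, X), ⟨hs, hX⟩, rfl⟩⟩
  have hMb : ∀ k, ‖M k‖ ≤ |K| / m := by
    intro k
    refine ContinuousLinearMap.opNorm_le_of_unit_norm (by positivity) fun X hX => ?_
    rw [le_div_iff₀ hm, mul_comm]
    refine (hmle _).trans ?_
    rw [← hM]
    exact (hK _ ⟨(ht k).le, ht1 k⟩ X (by simpa using hX)).trans (le_abs_self K)
  obtain ⟨M0, -, φ, hφ, hM0⟩ := tendsto_subseq_of_bounded (s := Metric.closedBall 0 (|K| / m))
    Metric.isBounded_closedBall (x := M) (fun k => by simpa using hMb k)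
  have htφ : Tendsto (fun k => t (φ k)) atTop (𝓝 0) := ht0.comp hφ.tendsto_atTop
  have hM0ψ : ∀ X, ψ (M0 X) = ψ X := by
    intro X
    have h1 : Tendsto (fun k => ψ (M (φ k) X)) atTop (𝓝 (ψ (M0 X))) :=
      (hψc.tendsto _).comp ((ContinuousLinearMap.apply ℝ (ℝ × ℝ) X).continuous.tendsto _ |>.comp hM0)
    have h2 : Tendsto (fun k => Φ (ι X + t (φ k) • l X • e)) atTop (𝓝 (Φ (ι X + (0:ℝ) • l X • e))) :=
      (hΦc.tendsto _).comp (tendsto_const_nhds.add (htφ.smul_const _))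
    simp only [hM] at h2
    rw [tendsto_nhds_unique h1 h2, zero_smul, add_zero, hψ]
  have hinj : Function.Injective (M0 : ℝ × ℝ →ₗ[ℝ] ℝ × ℝ) := by
    rw [← LinearMap.ker_eq_bot, LinearMap.ker_eq_bot']
    intro X hX
    by_contra hne
    have h1 := hM0ψ X
    have hX : M0 X = 0 := hX
    have h2 := hmle X
    have h3 := hpos X hne
    have h4 := hhom 0 le_rfl 0
    simp at h4
    rw [hX, h4] at h1; linarith
  let I0 : (ℝ × ℝ) ≃ₗ[ℝ] (ℝ × ℝ) := LinearEquiv.ofInjectiveEndo (M0 : ℝ × ℝ →ₗ[ℝ] ℝ × ℝ) hinj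
  let J : ℝ × ℝ →L[ℝ] ℝ × ℝ := LinearMap.toContinuousLinearMap (I0.symm : ℝ × ℝ →ₗ[ℝ] ℝ × ℝ)
  have hMJ : ∀ X, M0 (J X) = X := fun X => I0.apply_symm_apply X
  have hJM : ∀ X, J (M0 X) = X := fun X => I0.symm_apply_apply X
  have hJψ : ∀ X, ψ (J X) = ψ X := fun X => by rw [← hM0ψ (J X), hMJ]
  let D : ℕ → (ℝ × ℝ →L[ℝ] ℝ × ℝ) := fun k => J.comp (M (φ k)) - ContinuousLinearMap.id ℝ _
  have hD0 : Tendsto D atTop (𝓝 0) := by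
    have h1 : Tendsto (fun k => J.comp (M (φ k))) atTop (𝓝 (J.comp M0)) :=
      ((ContinuousLinearMap.compL ℝ (ℝ × ℝ) (ℝ × ℝ) (ℝ × ℝ) J).continuous.tendsto _).comp hM0
    have h2 : J.comp M0 = ContinuousLinearMap.id ℝ _ := by
      ext1 <;> ext <;> simp [hJM]
    have := h1.sub (tendsto_const_nhds (x := ContinuousLinearMap.id ℝ (ℝ × ℝ)))
    rwa [h2, sub_self] at this
  have hD : ∀ k X, ψ (X + D k X) = Φ (ι X + t (φ k) • l X • e) := by
    intro k X
    have : X + D k X = J (M (φ k) X) := by simp [D]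
    rw [this, hJψ, hM]
  let s : ℕ → ℝ := fun k => t (φ k) + ‖D k‖
  have hs : ∀ k, 0 < s k := fun k => add_pos_of_pos_of_nonneg (ht _) (norm_nonneg _)
  obtain ⟨⟨T, τ⟩, -, χ, hχ, hlim⟩ := tendsto_subseq_of_bounded
    (s := Metric.closedBall (0 : (ℝ × ℝ →L[ℝ] ℝ × ℝ) × ℝ) 1) Metric.isBounded_closedBall
    (x := fun k => ((s k)⁻¹ • D k, (s k)⁻¹ * t (φ k))) (fun k => by
      have h1 : ‖D k‖ ≤ s k := le_add_of_nonneg_left (ht _).le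
      have h2 : t (φ k) ≤ s k := le_add_of_nonneg_right (norm_nonneg _)
      have hs := hs k
      have ht := ht (φ k)
      rw [mem_closedBall_zero_iff, Prod.norm_def, max_le_iff]
      constructor
      · rw [norm_smul, norm_inv, Real.norm_of_nonneg hs.le, inv_mul_le_iff₀ hs, mul_one]
        exact h1
      · rw [norm_mul, norm_inv, Real.norm_of_nonneg hs.le, inv_mul_le_iff₀ hs, mul_one,
          Real.norm_of_nonneg ht.le]
        exact h2)
  have hT : Tendsto (fun k => (s (χ k))⁻¹ • D (χ k)) atTop (𝓝 T) :=
    (continuous_fst.tendsto _).comp hlim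
  have hτ : Tendsto (fun k => (s (χ k))⁻¹ * t (φ (χ k))) atTop (𝓝 τ) :=
    (continuous_snd.tendsto _).comp hlim
  have hsum : τ + ‖T‖ = 1 := by
    refine tendsto_nhds_unique (hτ.add hT.norm) (tendsto_const_nhds.congr fun k => ?_)
    have hs := hs (χ k)
    rw [norm_smul, norm_inv, Real.norm_of_nonneg hs.le, ← mul_add]
    exact (inv_mul_cancel₀ hs.ne').symm
  have hkey : ∀ X, X ≠ 0 → fderiv ℝ ψ X (T X) = τ * (l X * fderiv ℝ Φ (ι X) e) := by
    intro X hX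
    have hTX : Tendsto (fun k => (s (χ k))⁻¹ • (D (χ k) X)) atTop (𝓝 (T X)) := 
      (ContinuousLinearMap.apply ℝ (ℝ × ℝ) X).continuous.tendsto _ |>.comp hT
    have hDX : Tendsto (fun k => D (χ k) X) atTop (𝓝 0) := by
      have := ((ContinuousLinearMap.apply ℝ (ℝ × ℝ) X).continuous.tendsto _ |>.comp hD0).comp
        hχ.tendsto_atTop
      rw [map_zero] at this; exact this
    have h1 := (hasFDerivWithinAt_univ.2 (hψd X hX).hasFDerivAt).lim (c := fun k => (s (χ k))⁻¹)
      hDX (Eventually.of_forall fun _ => mem_univ _) hTX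
    have hEX : Tendsto (fun k => t (φ (χ k)) • l X • e) atTop (𝓝 0) := by
      simpa using (htφ.comp hχ.tendsto_atTop).smul_const (l X • e)
    have hEX' : Tendsto (fun k => (s (χ k))⁻¹ • t (φ (χ k)) • l X • e) atTop (𝓝 (τ • l X • e)) := by
      have := hτ.smul_const (l X • e)
      simpa only [mul_smul] using this
    have h2 := (hasFDerivWithinAt_univ.2 (hΦd _ (hι X hX)).hasFDerivAt).lim
      (c := fun k => (s (χ k))⁻¹)
      hEX (Eventually.of_forall fun _ => mem_univ _) hEX'
    simp only [hD] at h1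
    rw [hψ X] at h1
    have := tendsto_nhds_unique h1 h2
    rw [this]; simp
  have hτ0 : τ ≠ 0 := by
    intro hτ0
    have : T = 0 := hnd T (fun X hX => by rw [hkey X hX, hτ0, zero_mul])
    rw [this, hτ0] at hsum
    simp at hsum
  refine ⟨τ⁻¹ • T, fun X hX => ?_⟩
  rw [smul_apply, map_smul, hkey X hX, smul_eq_mul]
  field_simp


theorem poly4 (c0 c1 c2 c3 c4 δ : ℝ) (hδ : 0 < δ)
    (h : ∀ t : ℝ, |t| < δ → c0 + c1 * t + c2 * t ^ 2 + c3 * t ^ 3 + c4 * t ^ 4 = 0) : c4 = 0 := by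
  have e0 := h 0 (by simpa)
  have e1 := h (δ / 3) (by rw [abs_of_pos (by positivity)]; linarith)
  have e2 := h (-(δ / 3)) (by rw [abs_neg, abs_of_pos (by positivity)]; linarith)
  have e3 := h (2 * (δ / 3)) (by rw [abs_of_pos (by positivity)]; linarith)
  have e4 := h (-(2 * (δ / 3))) (by rw [abs_neg, abs_of_pos (by positivity)]; linarith)
  have : 24 * (δ / 3) ^ 4 * c4 = 0 := by
    linear_combination e3 + e4 - 4 * (e1 + e2) + 6 * e0
  exact (mul_eq_zero.1 this).resolve_left (by positivity)

section alg
variable {E : Type*} [NormedAddCommGroup E] [NormedSpace ℝ E]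

theorem polar_zero (C : E →L[ℝ] E →L[ℝ] E →L[ℝ] ℝ) (s1 : ∀ a b c, C a b c = C b a c)
    (s2 : ∀ a b c, C a b c = C a c b) (h : ∀ a, C a a a = 0) : C = 0 := by
  have h2 : ∀ a b, C a a b = 0 := by
    intro a b
    have e1 := h (a + b)
    have e2 := h (a - b)
    have e3 := h b
    simp only [map_add, map_sub, add_apply, sub_apply] at e1 e2
    rw [s2 a b a, s1 b a a, s2 a b a] at e1 e2
    linarith
  refine ContinuousLinearMap.ext fun a => ContinuousLinearMap.ext fun b =>
    ContinuousLinearMap.ext fun c => ?_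
  have e1 := h2 (a + b) c
  simp only [map_add, add_apply, h2] at e1
  rw [s1 b a c] at e1
  simp only [zero_apply]
  linarith

theorem caseI_alg (C : E →L[ℝ] E →L[ℝ] E →L[ℝ] ℝ) (s1 : ∀ a b c, C a b c = C b a c)
    (s2 : ∀ a b c, C a b c = C a c b) (y : E)
    (h : ∀ k : E, ∃ δ > 0, ∀ t : ℝ, |t| < δ → C (y + t • k) (y + t • k) (y + t • k) = 0) : C = 0 := by
  refine polar_zero C s1 s2 fun k => ?_
  obtain ⟨δ, hδ, hk⟩ := h k
  refine poly4 0 (C y y y) (C k y y + C y k y + C y y k) (C k k y + C k y k + C y k k) (C k k k) δ hδ ?_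
  intro t ht
  have := hk t ht
  simp only [map_add, map_smul, add_apply, smul_apply, smul_eq_mul] at this
  linear_combination t * this

theorem caseII_alg [FiniteDimensional ℝ E] (hdim : 3 ≤ Module.finrank ℝ E)
    (g : E →L[ℝ] E →L[ℝ] ℝ) (gs : ∀ a b, g a b = g b a) (gp : ∀ a, a ≠ 0 → 0 < g a a)
    (C : E →L[ℝ] E →L[ℝ] E →L[ℝ] ℝ) (s1 : ∀ a b c, C a b c = C b a c)
    (s2 : ∀ a b c, C a b c = C a c b) (x : E) (hx : x ≠ 0) (hCx : ∀ a b, C a b x = 0) (y : E)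
    (h : ∀ k : E, ∃ δ > 0, ∀ t : ℝ, |t| < δ → ∀ e, g x e = 0 → g (y + t • k) e = 0 → 
      C (y + t • k) (y + t • k) e = 0) : C = 0 := by
  have hCx1 : ∀ a b, C x a b = 0 := fun a b => by rw [s1, s2, hCx]
  have hCx2 : ∀ a b, C a x b = 0 := fun a b => by rw [s2, hCx]
  have gx := gp x hx
  set κ := g x y / g x x with hκ
  set z := y - κ • x with hz
  have hgz : g x z = 0 := by
    simp only [hz, map_sub, map_smul, smul_eq_mul, hκ]; field_simp; ring
  -- leading coefficient identity
  have key : ∀ k e, g x k = 0 → g x e = 0 → g k e = 0 → C k k e = 0 := by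
    intro k e hk he hke
    by_cases hk0 : k = 0
    · simp [hk0]
    obtain ⟨δ, hδ, H⟩ := h k
    have : g k k * C k k e - g k e * C k k k = 0 := by
      refine poly4 (g z z * C z z e - g z e * C z z z)
        ((g z k + g k z) * C z z e + g z z * (C z k e + C k z e)
          - g k e * C z z z - g z e * (C z z k + C z k z + C k z z))
        ((g z k + g k z) * (C z k e + C k z e) + g k k * C z z e + g z z * C k k e
          - g k e * (C z z k + C z k z + C k z z) - g z e * (C z k k + C k z k + C k k z))
        ((g z k + g k z) * C k k e + g k k * (C z k e + C k z e)
          - g k e * (C z k k + C k z k + C k k z) - g z e * C k k k) _ δ hδ ?_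
      intro t ht
      set Z := z + t • k with hZ
      have hyZ : y + t • k = Z + κ • x := by rw [hZ, hz]; module
      have hxZ : g x Z = 0 := by simp [hZ, hgz, hk]
      have H1 := H t ht (g Z Z • e - g Z e • Z) (by simp [he, hxZ]) (by
        rw [hyZ]
        simp [he, hxZ]; ring)
      rw [hyZ] at H1
      simp only [map_add, map_sub, map_smul, add_apply, smul_apply, smul_eq_mul, hCx1, hCx2,
        mul_zero, add_zero] at H1
      rw [hZ] at H1
      simp only [map_add, map_smul, add_apply, smul_apply, smul_eq_mul] at H1
      linear_combination H1
    rw [hke, zero_mul, sub_zero] at this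
    exact (mul_eq_zero.1 this).resolve_left (gp k hk0).ne'
  refine polar_zero C s1 s2 fun a => ?_
  set u := a - (g x a / g x x) • x with hu
  have hgu : g x u = 0 := by
    simp only [hu, map_sub, map_smul, smul_eq_mul]; field_simp; ring
  have hCu : C a a a = C u u u := by
    have : a = u + (g x a / g x x) • x := by rw [hu]; module
    conv_lhs => rw [this]
    simp only [map_add, map_smul, add_apply, smul_apply, smul_eq_mul, hCx1, hCx2, hCx,
        mul_zero, add_zero]
  rw [hCu]
  by_cases hu0 : u = 0
  · simp [hu0]
  -- find f
  obtain ⟨f, hf0, hxf, huf⟩ : ∃ f : E, f ≠ 0 ∧ g x f = 0 ∧ g u f = 0 := by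
    let L : E →ₗ[ℝ] ℝ × ℝ := ((g x).prod (g u) : E →L[ℝ] ℝ × ℝ)
    have hker : LinearMap.ker L ≠ ⊥ := by
      apply LinearMap.ker_ne_bot_of_finrank_lt
      simp
      omega
    obtain ⟨f, hf, hf0⟩ := Submodule.exists_mem_ne_zero_of_ne_bot hker
    have hf : (g x f, g u f) = (0 : ℝ × ℝ) := hf
    exact ⟨f, hf0, congrArg Prod.fst hf, congrArg Prod.snd hf⟩
  set c := Real.sqrt (g u u / g f f) with hc
  have hc2 : c ^ 2 * g f f = g u u := by
    rw [hc, Real.sq_sqrt (div_nonneg (gp u hu0).le (gp f hf0).le), div_mul_cancel₀ _ (gp f hf0).ne']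
  have main : ∀ c : ℝ, c ^ 2 * g f f = g u u → C u u u = c ^ 3 * C f f f := by
    intro c hc2
    have k1 := key (u + c • f) (u - c • f) (by simp [hgu, hxf]) (by simp [hgu, hxf]) (by
      simp [huf, gs f u, ← hc2]; ring)
    have k2 := key u f hgu hxf huf
    have k3 := key f u hxf hgu (by rw [gs, huf])
    simp only [map_add, map_sub, map_smul, add_apply, smul_apply, smul_eq_mul] at k1
    rw [s2 u f u, s1 f u u, s2 u f u, k2, s1 u f f, s2 f u f, k3] at k1
    linear_combination k1
  have m1 := main c hc2
  have m2 := main (-c) (by rw [neg_sq, hc2])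
  linarith [show (-c) ^ 3 * C f f f = - (c ^ 3 * C f f f) by ring]

theorem line_deriv (G : E → ℝ) (x u : E) (hG : DifferentiableAt ℝ G x) (k0 k1 k2 : ℝ)
    (h : ∀ᶠ s in 𝓝 (0:ℝ), G (x + s • u) = k0 + k1 * s + k2 * s ^ 2) : fderiv ℝ G x u = k1 := by
  have h1 : HasDerivAt (fun s : ℝ => x + s • u) u 0 := by
    simpa using ((hasDerivAt_id (0:ℝ)).smul_const u).const_add x
  have h2 : HasDerivAt (fun s : ℝ => G (x + s • u)) (fderiv ℝ G x u) 0 := by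
    have hG' : HasFDerivAt G (fderiv ℝ G x) (x + (0:ℝ) • u) := by simpa using hG.hasFDerivAt
    exact hG'.comp_hasDerivAt (0:ℝ) h1
  have h3 : HasDerivAt (fun s : ℝ => k0 + k1 * s + k2 * s ^ 2) k1 0 := by
    have := (((hasDerivAt_id (0:ℝ)).const_mul k1).const_add k0).fun_add
      (((hasDerivAt_id (0:ℝ)).pow 2).const_mul k2)
    simpa using this
  exact h2.unique (h3.congr_of_eventuallyEq h)

theorem two_le_top' : (2 : WithTop ℕ∞) ≤ ((⊤ : ℕ∞) : WithTop ℕ∞) :=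
  WithTop.coe_le_coe.2 (le_top : (2 : ℕ∞) ≤ ⊤)

variable (F : E → ℝ) (hF : ContDiffOn ℝ (⊤ : ℕ∞) F {(0 : E)}ᶜ)
include hF

theorem cd0 (x : E) (hx : x ≠ 0) : ContDiffAt ℝ (⊤ : ℕ∞) F x :=
  hF.contDiffAt (isOpen_compl_singleton.mem_nhds hx)
theorem cd1 (x : E) (hx : x ≠ 0) : ContDiffAt ℝ (⊤ : ℕ∞) (fderiv ℝ F) x :=
  (cd0 F hF x hx).fderiv_right (by simp)
theorem cd2 (x : E) (hx : x ≠ 0) : ContDiffAt ℝ (⊤ : ℕ∞) (fderiv ℝ (fderiv ℝ F)) x :=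
  (cd1 F hF x hx).fderiv_right (by simp)
theorem df0 (x : E) (hx : x ≠ 0) : DifferentiableAt ℝ F x :=
  (cd0 F hF x hx).differentiableAt (by simp)
theorem df1 (x : E) (hx : x ≠ 0) : DifferentiableAt ℝ (fderiv ℝ F) x :=
  (cd1 F hF x hx).differentiableAt (by simp)
theorem df2 (x : E) (hx : x ≠ 0) : DifferentiableAt ℝ (fderiv ℝ (fderiv ℝ F)) x :=
  (cd2 F hF x hx).differentiableAt (by simp)

theorem sym2 (x : E) (hx : x ≠ 0) (a b : E) :
    fderiv ℝ (fderiv ℝ F) x a b = fderiv ℝ (fderiv ℝ F) x b a :=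
  ((cd0 F hF x hx).isSymmSndFDerivAt (by simp; exact two_le_top')) a b

theorem ap1 (x : E) (hx : x ≠ 0) (a b : E) :
    fderiv ℝ (fun z => fderiv ℝ F z b) x a = fderiv ℝ (fderiv ℝ F) x a b := by
  rw [fderiv_clm_apply (df1 F hF x hx) (differentiableAt_const b)]; simp

theorem ap2 (x : E) (hx : x ≠ 0) (a b c : E) :
    fderiv ℝ (fun z => fderiv ℝ (fderiv ℝ F) z b c) x a =
      fderiv ℝ (fderiv ℝ (fderiv ℝ F)) x a b c := by
  rw [fderiv_clm_apply ((df2 F hF x hx).clm_apply (differentiableAt_const b)) (differentiableAt_const c)]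
  rw [fderiv_clm_apply (df2 F hF x hx) (differentiableAt_const b)]; simp

theorem dap1 (x : E) (hx : x ≠ 0) (b : E) : DifferentiableAt ℝ (fun z => fderiv ℝ F z b) x :=
  (df1 F hF x hx).clm_apply (differentiableAt_const b)
theorem dap2 (x : E) (hx : x ≠ 0) (b c : E) :
    DifferentiableAt ℝ (fun z => fderiv ℝ (fderiv ℝ F) z b c) x :=
  ((df2 F hF x hx).clm_apply (differentiableAt_const b)).clm_apply (differentiableAt_const c)

theorem sym3a (x : E) (hx : x ≠ 0) (a b c : E) :
    fderiv ℝ (fderiv ℝ (fderiv ℝ F)) x a b c = fderiv ℝ (fderiv ℝ (fderiv ℝ F)) x b a c := by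
  have := ((cd1 F hF x hx).isSymmSndFDerivAt (by simp; exact two_le_top')) a b
  rw [this]

theorem sym3b (x : E) (hx : x ≠ 0) (a b c : E) :
    fderiv ℝ (fderiv ℝ (fderiv ℝ F)) x a b c = fderiv ℝ (fderiv ℝ (fderiv ℝ F)) x a c b := by
  rw [← ap2 F hF x hx, ← ap2 F hF x hx]
  have : (fun z => fderiv ℝ (fderiv ℝ F) z b c) =ᶠ[𝓝 x] (fun z => fderiv ℝ (fderiv ℝ F) z c b) := by
    filter_upwards [isOpen_compl_singleton.mem_nhds hx] with z hz
    exact sym2 F hF z hz b c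
  rw [this.fderiv_eq]

theorem euler1 (hh : ∀ t : ℝ, 0 ≤ t → ∀ x, F (t • x) = t ^ 2 * F x) (x : E) (hx : x ≠ 0) :
    fderiv ℝ F x x = 2 * F x := by
  refine line_deriv F x x (df0 F hF x hx) (F x) (2 * F x) (F x) ?_
  filter_upwards [lt_mem_nhds (show (-1:ℝ) < 0 by norm_num)] with s hs
  have : x + s • x = (1 + s) • x := by module
  rw [this, hh _ (by linarith)]; ring

theorem euler2 (hh : ∀ t : ℝ, 0 ≤ t → ∀ x, F (t • x) = t ^ 2 * F x) (x : E) (hx : x ≠ 0) (u : E) :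
    fderiv ℝ (fderiv ℝ F) x u x = fderiv ℝ F x u := by
  have h1 : (fun z => fderiv ℝ F z z) =ᶠ[𝓝 x] (fun z => 2 * F z) := by
    filter_upwards [isOpen_compl_singleton.mem_nhds hx] with z hz
    exact euler1 F hF hh z hz
  have h2 := congrArg (fun L : E →L[ℝ] ℝ => L u) h1.fderiv_eq
  rw [fderiv_clm_apply (df1 F hF x hx) differentiableAt_fun_id, fderiv_const_mul (df0 F hF x hx)] at h2
  simp at h2
  linarith

theorem euler3 (hh : ∀ t : ℝ, 0 ≤ t → ∀ x, F (t • x) = t ^ 2 * F x) (x : E) (hx : x ≠ 0) (a u : E) :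
    fderiv ℝ (fderiv ℝ (fderiv ℝ F)) x a u x = 0 := by
  have h1 : (fun z => fderiv ℝ (fderiv ℝ F) z u z) =ᶠ[𝓝 x] (fun z => fderiv ℝ F z u) := by
    filter_upwards [isOpen_compl_singleton.mem_nhds hx] with z hz
    exact euler2 F hF hh z hz u
  have h2 := congrArg (fun L : E →L[ℝ] ℝ => L a) h1.fderiv_eq
  simp only [ap1 F hF x hx] at h2
  rw [fderiv_clm_apply ((df2 F hF x hx).clm_apply (differentiableAt_const u)) differentiableAt_fun_id,
    fderiv_clm_apply (df2 F hF x hx) (differentiableAt_const u)] at h2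
  simp at h2
  rw [sym2 F hF x hx u a] at h2
  linarith

theorem planeI (ι : ℝ × ℝ →L[ℝ] E) (hι : ∀ X, X ≠ 0 → ι X ≠ 0) (α β γ : ℝ)
    (h : ∀ X, F (ι X) = α * X.1 ^ 2 + β * X.1 * X.2 + γ * X.2 ^ 2) (X U : ℝ × ℝ) (hX : X ≠ 0) :
    fderiv ℝ (fderiv ℝ (fderiv ℝ F)) (ι X) (ι U) (ι U) (ι U) = 0 := by
  have ne : ∀ X : ℝ × ℝ, X ≠ 0 → ∀ U, ∀ᶠ s in 𝓝 (0:ℝ), X + s • U ≠ 0 := by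
    intro X hX U
    have h0 : ContinuousAt (fun s : ℝ => X + s • U) 0 := by fun_prop
    exact h0.eventually_ne (by simpa using hX)
  have d1 : ∀ X, X ≠ 0 → ∀ U, fderiv ℝ F (ι X) (ι U) =
      2 * α * X.1 * U.1 + β * (X.1 * U.2 + X.2 * U.1) + 2 * γ * X.2 * U.2 := by
    intro X hX U
    refine line_deriv F _ _ (df0 F hF _ (hι X hX)) (F (ι X)) _ (F (ι U)) ?_
    refine Eventually.of_forall fun s => ?_
    rw [← map_smul, ← map_add, h, h, h]
    simp; ring
  have d2 : ∀ X, X ≠ 0 → fderiv ℝ (fderiv ℝ F) (ι X) (ι U) (ι U) = 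
      2 * α * U.1 * U.1 + β * (U.1 * U.2 + U.2 * U.1) + 2 * γ * U.2 * U.2 := by
    intro X hX
    rw [← ap1 F hF _ (hι X hX)]
    refine line_deriv _ _ _ (dap1 F hF _ (hι X hX) _) (fderiv ℝ F (ι X) (ι U)) _ 0 ?_
    filter_upwards [ne X hX U] with s hs
    rw [← map_smul, ← map_add, d1 _ hs, d1 _ hX]
    simp; ring
  rw [← ap2 F hF _ (hι X hX)]
  refine line_deriv _ _ _ (dap2 F hF _ (hι X hX) _ _) (fderiv ℝ (fderiv ℝ F) (ι X) (ι U) (ι U)) _ 0 ?_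
  filter_upwards [ne X hX U] with s hs
  rw [← map_smul, ← map_add, d2 _ hs, d2 _ hX]
  ring

theorem planeII (ι : ℝ × ℝ →L[ℝ] E) (hι : ∀ X, X ≠ 0 → ι X ≠ 0) (f : E)
    (h : ∀ X, X ≠ 0 → fderiv ℝ F (ι X) f = 0) (X : ℝ × ℝ) (hX : X ≠ 0) :
    (∀ U, fderiv ℝ (fderiv ℝ F) (ι X) (ι U) f = 0) ∧
    (∀ U, fderiv ℝ (fderiv ℝ (fderiv ℝ F)) (ι X) (ι U) (ι U) f = 0) := by
  have ne : ∀ X : ℝ × ℝ, X ≠ 0 → ∀ U, ∀ᶠ s in 𝓝 (0:ℝ), X + s • U ≠ 0 := by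
    intro X hX U
    have h0 : ContinuousAt (fun s : ℝ => X + s • U) 0 := by fun_prop
    exact h0.eventually_ne (by simpa using hX)
  have d2 : ∀ X, X ≠ 0 → ∀ U, fderiv ℝ (fderiv ℝ F) (ι X) (ι U) f = 0 := by
    intro X hX U
    rw [← ap1 F hF _ (hι X hX)]
    refine line_deriv _ _ _ (dap1 F hF _ (hι X hX) _) 0 _ 0 ?_
    filter_upwards [ne X hX U] with s hs
    rw [← map_smul, ← map_add, h _ hs]
    simp
  refine ⟨d2 X hX, fun U => ?_⟩
  rw [← ap2 F hF _ (hι X hX)]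
  refine line_deriv _ _ _ (dap2 F hF _ (hι X hX) _ _) 0 _ 0 ?_
  filter_upwards [ne X hX U] with s hs
  rw [← map_smul, ← map_add, d2 _ hs]
  simp
end alg


section main
variable {E : Type*} [NormedAddCommGroup E] [NormedSpace ℝ E]

def iota (v w : E) : ℝ × ℝ →L[ℝ] E :=
  (ContinuousLinearMap.fst ℝ ℝ ℝ).smulRight v + (ContinuousLinearMap.snd ℝ ℝ ℝ).smulRight w

theorem iota_apply (v w : E) (X : ℝ × ℝ) : iota v w X = X.1 • v + X.2 • w := by simp [iota]

theorem pert (v₀ w₀ : E) (ε : ℝ) (v w : E) (hv : ‖v - v₀‖ < ε) (hw : ‖w - w₀‖ < ε) (p q : E) :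
    ∃ δ > 0, ∀ t : ℝ, |t| < δ → ‖v + t • p - v₀‖ < ε ∧ ‖w + t • q - w₀‖ < ε := by
  have c1 : ContinuousAt (fun t : ℝ => ‖v + t • p - v₀‖) 0 := by fun_prop
  have c2 : ContinuousAt (fun t : ℝ => ‖w + t • q - w₀‖) 0 := by fun_prop
  have h1 : ∀ᶠ t in 𝓝 (0:ℝ), ‖v + t • p - v₀‖ < ε := c1.eventually_lt_const (by simpa using hv)
  have h2 : ∀ᶠ t in 𝓝 (0:ℝ), ‖w + t • q - w₀‖ < ε := c2.eventually_lt_const (by simpa using hw)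
  obtain ⟨δ, hδ, h⟩ := Metric.eventually_nhds_iff.1 (h1.and h2)
  exact ⟨δ, hδ, fun t ht => h (by simpa using ht)⟩

theorem r_pos (X : ℝ × ℝ) (hX : X ≠ 0) : 0 < X.1 ^ 2 + X.2 ^ 2 := by
  rcases not_and_or.1 (fun h : X.1 = 0 ∧ X.2 = 0 => hX (Prod.ext h.1 h.2)) with h | h <;> positivity

theorem pert2 (v₀ w₀ : E) (ε : ℝ) (v w : E) (hv : ‖v - v₀‖ < ε) (hw : ‖w - w₀‖ < ε)
    (X : ℝ × ℝ) (hX : X ≠ 0) (k : E) :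
    ∃ δ > 0, ∀ t : ℝ, |t| < δ → ∃ v' w', ‖v' - v₀‖ < ε ∧ ‖w' - w₀‖ < ε ∧
      iota v' w' X = iota v w X ∧ iota v' w' (-X.2, X.1) = iota v w (-X.2, X.1) + t • k := by
  have hr := r_pos X hX
  obtain ⟨δ, hδ, h⟩ := pert v₀ w₀ ε v w hv hw (-(X.2 / (X.1 ^ 2 + X.2 ^ 2)) • k)
    ((X.1 / (X.1 ^ 2 + X.2 ^ 2)) • k)
  refine ⟨δ, hδ, fun t ht => ⟨_, _, (h t ht).1, (h t ht).2, ?_, ?_⟩⟩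
  · simp only [iota_apply]; module
  · simp only [iota_apply]
    match_scalars <;> field_simp
    ring

theorem cont_Φ [FiniteDimensional ℝ E] (Φ : E → ℝ) (hΦ : IsBanachMinkowski Φ) : Continuous Φ := by
  obtain ⟨h0, hpos, hhom, hsub, -, -⟩ := hΦ
  have hconv : ConvexOn ℝ univ Φ := by
    refine ⟨convex_univ, fun x _ y _ a b ha hb _ => ?_⟩
    refine (hsub _ _).trans ?_
    rw [hhom a ha, hhom b hb]; rfl
  exact continuousOn_univ.1 (hconv.continuousOn isOpen_univ)

theorem euler_hom (ψ : E → ℝ) (hhom : ∀ t : ℝ, 0 ≤ t → ∀ X, ψ (t • X) = t * ψ X) (X : E)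
    (hd : DifferentiableAt ℝ ψ X) : fderiv ℝ ψ X X = ψ X := by
  refine line_deriv ψ X X hd (ψ X) (ψ X) 0 ?_
  filter_upwards [lt_mem_nhds (show (-1:ℝ) < 0 by norm_num)] with s hs
  have : X + s • X = (1 + s) • X := by module
  rw [this, hhom _ (by linarith)]; ring

theorem caseII_plane [FiniteDimensional ℝ E]
    (Φ : E → ℝ) (hΦ : IsBanachMinkowski Φ) (v₀ w₀ : E) (ε : ℝ)
    (hLI : ∀ v w : E, ‖v - v₀‖ < ε → ‖w - w₀‖ < ε → ∀ X, X ≠ 0 → iota v w X ≠ 0)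
    (hEq : ∀ v w v' w' : E, ‖v - v₀‖ < ε → ‖w - w₀‖ < ε → ‖v' - v₀‖ < ε → ‖w' - w₀‖ < ε →
      ∃ M : ℝ × ℝ →L[ℝ] ℝ × ℝ, ∀ X, Φ (iota v' w' X) = Φ (iota v w (M X)))
    (v w : E) (hv : ‖v - v₀‖ < ε) (hw : ‖w - w₀‖ < ε)
    (hnq : ¬ ∃ α β γ : ℝ, ∀ X : ℝ × ℝ, Φ (iota v w X) ^ 2 = α * X.1 ^ 2 + β * X.1 * X.2 + γ * X.2 ^ 2)
    (e : E) : ∃ c : ℝ × ℝ, ∀ X, X ≠ 0 → fderiv ℝ Φ (iota v w X) (e - iota v w c) = 0 := by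
  have hΦc := cont_Φ Φ hΦ
  obtain ⟨h0, hpos, hhom, hsub, hsm, -⟩ := hΦ
  have hι := hLI v w hv hw
  set ι := iota v w with hιdef
  set ψ : ℝ × ℝ → ℝ := fun X => Φ (ι X) with hψ
  have hψ0 : ψ 0 = 0 := by simp [hψ, h0]
  have hψpos : ∀ X, X ≠ 0 → 0 < ψ X := fun X hX => hpos _ (hι X hX)
  have hψhom : ∀ t : ℝ, 0 ≤ t → ∀ X, ψ (t • X) = t * ψ X := fun t ht X => by
    simp only [hψ, map_smul, hhom t ht]
  have hψsm : ContDiffOn ℝ (⊤ : ℕ∞) ψ {0}ᶜ := by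
    refine hsm.comp ι.contDiff.contDiffOn ?_
    intro X hX
    exact hι X hX
  have hψc : ContinuousOn (fderiv ℝ ψ) {0}ᶜ :=
    hψsm.continuousOn_fderiv_of_isOpen isOpen_compl_singleton (by simp)
  have hΦd := df0 Φ hsm
  have hψd := df0 ψ hψsm
  have hψe : ∀ X, X ≠ 0 → fderiv ℝ ψ X X = ψ X := fun X hX => euler_hom ψ hψhom X (hψd X hX)
  have hnd : ∀ N : ℝ × ℝ →L[ℝ] ℝ × ℝ, (∀ X, X ≠ 0 → fderiv ℝ ψ X (N X) = 0) → N = 0 := by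
    intro N hN
    by_contra hne
    exact hnq (rot_lemma ψ hψc hψd hψ0 hψhom hψpos hψe N hne hN)
  have hT : ∀ (l : ℝ × ℝ →L[ℝ] ℝ) (p q : E) (_ : ∀ t : ℝ, ∀ X, ι X + t • l X • e =
      iota (v + t • p) (w + t • q) X), ∃ T : ℝ × ℝ →L[ℝ] ℝ × ℝ, ∀ X, X ≠ 0 →
      l X * fderiv ℝ Φ (ι X) e = fderiv ℝ ψ X (T X) := by
    intro l p q hl
    obtain ⟨δ, hδ, hpert⟩ := pert v₀ w₀ ε v w hv hw p q
    let t : ℕ → ℝ := fun k => (δ / 2) * (1 / ((k : ℝ) + 1))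
    have ht : ∀ k, 0 < t k := fun k => by positivity
    have ht0 : Tendsto t atTop (𝓝 0) := by
      have := (tendsto_one_div_add_atTop_nhds_zero_nat (𝕜 := ℝ)).const_mul (δ / 2)
      rwa [mul_zero] at this
    have htδ : ∀ k, |t k| < δ := fun k => by
      rw [abs_of_pos (ht k)]
      have : 1 / ((k : ℝ) + 1) ≤ 1 := by
        rw [div_le_one (by positivity)]; linarith [(Nat.cast_nonneg k : (0:ℝ) ≤ k)]
      calc t k ≤ (δ / 2) * 1 := by simp only [t]; gcongr
        _ < δ := by linarith
    choose M hM using fun k => hEq v w _ _ hv hw (hpert (t k) (htδ k)).1 (hpert (t k) (htδ k)).2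
    refine limit_lemma Φ hΦd ι hι ψ (fun _ => rfl) hΦc hψhom hψpos hnd e l t ht ht0 M ?_
    intro k X
    rw [hl, hM]
  obtain ⟨T1, hT1⟩ := hT (ContinuousLinearMap.fst ℝ ℝ ℝ) e 0 (fun t X => by
    simp only [hιdef, iota_apply, ContinuousLinearMap.coe_fst']; module)
  obtain ⟨T2, hT2⟩ := hT (ContinuousLinearMap.snd ℝ ℝ ℝ) 0 e (fun t X => by
    simp only [hιdef, iota_apply, ContinuousLinearMap.coe_snd']; module)
  obtain ⟨c, hc⟩ := elim_lemma ψ hψc hψpos hψe hnd T1 T2 (fun X => fderiv ℝ Φ (ι X) e) hT1 hT2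
  refine ⟨c, fun X hX => ?_⟩
  have h1 : fderiv ℝ ψ X c = fderiv ℝ Φ (ι X) (ι c) := by
    have : HasFDerivAt ψ ((fderiv ℝ Φ (ι X)).comp ι) X :=
      (hΦd _ (hι X hX)).hasFDerivAt.comp X ι.hasFDerivAt
    rw [this.fderiv]; rfl
  rw [map_sub, ← h1, ← hc X hX, sub_self]

theorem main_D3 [FiniteDimensional ℝ E] (hdim : 3 ≤ Module.finrank ℝ E)
    (Φ : E → ℝ) (hΦ : IsBanachMinkowski Φ) (v₀ w₀ : E) (ε : ℝ)
    (hLI : ∀ v w : E, ‖v - v₀‖ < ε → ‖w - w₀‖ < ε → ∀ X, X ≠ 0 → iota v w X ≠ 0)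
    (hEq : ∀ v w v' w' : E, ‖v - v₀‖ < ε → ‖w - w₀‖ < ε → ‖v' - v₀‖ < ε → ‖w' - w₀‖ < ε →
      ∃ M : ℝ × ℝ →L[ℝ] ℝ × ℝ, ∀ X, Φ (iota v' w' X) = Φ (iota v w (M X)))
    (F : E → ℝ) (hFdef : F = fun u => Φ u ^ 2)
    (v w : E) (hv : ‖v - v₀‖ < ε) (hw : ‖w - w₀‖ < ε) (X : ℝ × ℝ) (hX : X ≠ 0) :
    fderiv ℝ (fderiv ℝ (fderiv ℝ F)) (iota v w X) = 0 := by
  have hΦ' := hΦ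
  obtain ⟨h0, hpos, hhom, hsub, hsm, hconv⟩ := hΦ
  have hF : ContDiffOn ℝ (⊤ : ℕ∞) F {(0 : E)}ᶜ := by rw [hFdef]; exact hsm.pow 2
  have hFh : ∀ t : ℝ, 0 ≤ t → ∀ x, F (t • x) = t ^ 2 * F x := by
    intro t ht x; simp only [hFdef, hhom t ht]; ring
  have hx := hLI v w hv hw X hX
  by_cases hq : ∃ v w, ‖v - v₀‖ < ε ∧ ‖w - w₀‖ < ε ∧ ∃ α β γ : ℝ, ∀ X : ℝ × ℝ,
      Φ (iota v w X) ^ 2 = α * X.1 ^ 2 + β * X.1 * X.2 + γ * X.2 ^ 2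
  · obtain ⟨v1, w1, hv1, hw1, α, β, γ, h1⟩ := hq
    have hall : ∀ v w : E, ‖v - v₀‖ < ε → ‖w - w₀‖ < ε → ∃ α β γ : ℝ, ∀ X : ℝ × ℝ,
      F (iota v w X) = α * X.1 ^ 2 + β * X.1 * X.2 + γ * X.2 ^ 2 := by
      intro v w hv hw
      obtain ⟨M, hM⟩ := hEq v1 w1 v w hv1 hw1 hv hw
      refine ⟨α * (M (1,0)).1 ^ 2 + β * (M (1,0)).1 * (M (1,0)).2 + γ * (M (1,0)).2 ^ 2,
        2 * α * (M (1,0)).1 * (M (0,1)).1 + β * ((M (1,0)).1 * (M (0,1)).2 + (M (1,0)).2 * (M (0,1)).1)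
          + 2 * γ * (M (1,0)).2 * (M (0,1)).2,
        α * (M (0,1)).1 ^ 2 + β * (M (0,1)).1 * (M (0,1)).2 + γ * (M (0,1)).2 ^ 2, fun X => ?_⟩
      simp only [hFdef]
      rw [hM, h1, clm2_apply M X]
      ring
    refine caseI_alg _ (sym3a F hF _ hx) (sym3b F hF _ hx) (iota v w (-X.2, X.1)) ?_
    intro k
    obtain ⟨δ, hδ, h⟩ := pert2 v₀ w₀ ε v w hv hw X hX k
    refine ⟨δ, hδ, fun t ht => ?_⟩
    obtain ⟨v', w', hv', hw', e1, e2⟩ := h t ht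
    obtain ⟨α', β', γ', h'⟩ := hall v' w' hv' hw'
    have := planeI F hF (iota v' w') (hLI v' w' hv' hw') α' β' γ' h' X (-X.2, X.1) hX
    rwa [e1, e2] at this
  · have hgp : ∀ x, x ≠ 0 → ∀ a, a ≠ 0 → 0 < fderiv ℝ (fderiv ℝ F) x a a := by
      intro x hx a ha
      have := hconv x hx a ha
      rw [iteratedFDeriv_two_apply, ← hFdef] at this
      simpa using this
    refine caseII_alg hdim (fderiv ℝ (fderiv ℝ F) (iota v w X)) (sym2 F hF _ hx) (hgp _ hx) _
      (sym3a F hF _ hx) (sym3b F hF _ hx) (iota v w X) hx (euler3 F hF hFh _ hx)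
      (iota v w (-X.2, X.1)) ?_
    intro k
    obtain ⟨δ, hδ, h⟩ := pert2 v₀ w₀ ε v w hv hw X hX k
    refine ⟨δ, hδ, fun t ht e hge hge' => ?_⟩
    obtain ⟨v', w', hv', hw', e1, e2⟩ := h t ht
    rw [← e1] at hge hge' ⊢
    rw [← e2] at hge' ⊢
    have hι' := hLI v' w' hv' hw'
    have hx' := hι' X hX
    obtain ⟨c, hc⟩ := caseII_plane Φ hΦ' v₀ w₀ ε hLI hEq v' w' hv' hw'
      (fun h => hq ⟨v', w', hv', hw', h⟩) e
    have hFc : ∀ Z, Z ≠ 0 → fderiv ℝ F (iota v' w' Z) (e - iota v' w' c) = 0 := by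
      intro Z hZ
      have h1 := ((df0 Φ hsm _ (hι' Z hZ)).hasFDerivAt.pow 2)
      rw [hFdef, h1.fderiv]
      have h3 := hc Z hZ
      simp only [map_sub] at h3
      simp [h3]
    obtain ⟨p2, p3⟩ := planeII F hF (iota v' w') hι' (e - iota v' w' c) hFc X hX
    have hr := r_pos X hX
    have hU : ∀ U, fderiv ℝ (fderiv ℝ F) (iota v' w' X) (iota v' w' U) e = 0 := by
      intro U
      have : (X.1 ^ 2 + X.2 ^ 2) • U = (X.1 * U.1 + X.2 * U.2) • X + (X.1 * U.2 - X.2 * U.1) • (-X.2, X.1) := by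
        ext <;> simp <;> ring
      have h1 : (X.1 ^ 2 + X.2 ^ 2) * fderiv ℝ (fderiv ℝ F) (iota v' w' X) (iota v' w' U) e = 0 := by
        have h2 := congrArg (fun Z => fderiv ℝ (fderiv ℝ F) (iota v' w' X) (iota v' w' Z) e) this
        simp only [map_add, map_smul, add_apply, smul_apply, hge, hge', smul_zero, add_zero,
          smul_eq_mul, mul_zero] at h2
        exact h2
      exact (mul_eq_zero.1 h1).resolve_left hr.ne'
    have hc0 : iota v' w' c = 0 := by
      by_contra hne
      have h1 := hgp _ hx' _ hne
      have h2 := p2 c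
      rw [map_sub, hU c] at h2
      linarith
    have := p3 (-X.2, X.1)
    rwa [hc0, sub_zero] at this
end main


theorem hom_le {V : Type*} [AddCommGroup V] [Module ℝ V] (p q : V → ℝ)
    (hp : ∀ t : ℝ, 0 ≤ t → ∀ v, p (t • v) = t * p v) (hq : ∀ t : ℝ, 0 ≤ t → ∀ v, q (t • v) = t * q v)
    (hq0 : ∀ v, 0 ≤ q v) (h : ∀ v, q v ≤ 1 → p v ≤ 1) (v : V) : p v ≤ q v := by
  refine le_of_forall_gt_imp_ge_of_dense fun s hs => ?_
  have hs0 : 0 < s := (hq0 v).trans_lt hs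
  have := h (s⁻¹ • v) (by
    rw [hq _ (by positivity), inv_mul_le_iff₀ hs0]; linarith)
  rw [hp _ (by positivity), inv_mul_le_iff₀ hs0] at this
  linarith

theorem iota_mem {E : Type*} [NormedAddCommGroup E] [NormedSpace ℝ E] (v w : E) (X : ℝ × ℝ) :
    iota v w X ∈ (Submodule.span ℝ {v, w} : Submodule ℝ E) := by
  rw [iota_apply, Submodule.mem_span_pair]
  exact ⟨X.1, X.2, rfl⟩

theorem exists_coord {E : Type*} [NormedAddCommGroup E] [NormedSpace ℝ E] (v w : E)
    (h : ∀ X, X ≠ 0 → iota v w X ≠ 0) :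
    ∃ J : (ℝ × ℝ) ≃ₗ[ℝ] (Submodule.span ℝ {v, w} : Submodule ℝ E), ∀ X, (J X : E) = iota v w X := by
  let j : (ℝ × ℝ) →ₗ[ℝ] (Submodule.span ℝ {v, w} : Submodule ℝ E) :=
    LinearMap.codRestrict _ (iota v w : ℝ × ℝ →ₗ[ℝ] E) (iota_mem v w)
  have hj : ∀ X, (j X : E) = iota v w X := fun X => rfl
  refine ⟨LinearEquiv.ofBijective j ⟨?_, ?_⟩, hj⟩
  · rw [← LinearMap.ker_eq_bot, LinearMap.ker_eq_bot']
    intro X hX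
    by_contra hne
    refine h X hne ?_
    rw [← hj, hX]; rfl
  · rintro ⟨z, hz⟩
    obtain ⟨a, b, hab⟩ := Submodule.mem_span_pair.1 hz
    refine ⟨(a, b), Subtype.ext ?_⟩
    rw [hj, iota_apply]; exact hab

theorem near_LI {E : Type*} [NormedAddCommGroup E] [NormedSpace ℝ E] [FiniteDimensional ℝ E]
    (v₀ w₀ : E) (hvw : LinearIndependent ℝ ![v₀, w₀]) :
    ∃ δ > 0, ∀ v w : E, ‖v - v₀‖ < δ → ‖w - w₀‖ < δ → LinearIndependent ℝ ![v, w] := by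
  have hopen : IsOpen {f : Fin 2 → E | LinearIndependent ℝ f} := isOpen_setOfPred_linearIndependent
  obtain ⟨δ, hδ, h⟩ := Metric.isOpen_iff.1 hopen _ hvw
  refine ⟨δ, hδ, fun v w hv hw => h ?_⟩
  rw [Metric.mem_ball, dist_pi_lt_iff hδ]
  intro i
  fin_cases i <;> simpa [dist_eq_norm]

theorem iota_ne {E : Type*} [NormedAddCommGroup E] [NormedSpace ℝ E] (v w : E)
    (h : LinearIndependent ℝ ![v, w]) (X : ℝ × ℝ) (hX : X ≠ 0) : iota v w X ≠ 0 := by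
  intro h0
  rw [iota_apply] at h0
  have := LinearIndependent.pair_iff.1 h _ _ h0
  exact hX (Prod.ext this.1 this.2)

theorem final_lemma {E : Type*} [NormedAddCommGroup E] [NormedSpace ℝ E] [FiniteDimensional ℝ E]
    (hdim : 3 ≤ Module.finrank ℝ E)
    (Φ : E → ℝ) (hΦ : IsBanachMinkowski Φ) (v₀ w₀ : E) (ε : ℝ) (hε : 0 < ε)
    (hLI : ∀ v w : E, ‖v - v₀‖ < ε → ‖w - w₀‖ < ε → ∀ X, X ≠ 0 → iota v w X ≠ 0)
    (hEq : ∀ v w v' w' : E, ‖v - v₀‖ < ε → ‖w - w₀‖ < ε → ‖v' - v₀‖ < ε → ‖w' - w₀‖ < ε →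
      ∃ M : ℝ × ℝ →L[ℝ] ℝ × ℝ, ∀ X, Φ (iota v' w' X) = Φ (iota v w (M X))) :
    ∃ Q : QuadraticForm ℝ E, Q.PosDef ∧ ∃ W : Set E, IsOpen W ∧
      (∀ X, X ≠ 0 → iota v₀ w₀ X ∈ W) ∧ (∀ u ∈ W, Φ u ^ 2 = Q u) := by
  obtain ⟨F, hFdef⟩ : ∃ F : E → ℝ, F = fun u => Φ u ^ 2 := ⟨_, rfl⟩
  have hD3 := main_D3 hdim Φ hΦ v₀ w₀ ε hLI hEq F hFdef
  obtain ⟨h0, hpos, hhom, hsub, hsm, hconv⟩ := hΦ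
  have hF : ContDiffOn ℝ (⊤ : ℕ∞) F {(0 : E)}ᶜ := by rw [hFdef]; exact hsm.pow 2
  have hFh : ∀ t : ℝ, 0 ≤ t → ∀ x, F (t • x) = t ^ 2 * F x := by
    intro t ht x; simp only [hFdef, hhom t ht]; ring
  have hgp : ∀ x, x ≠ 0 → ∀ a, a ≠ 0 → 0 < fderiv ℝ (fderiv ℝ F) x a a := by
    intro x hx a ha
    have := hconv x hx a ha
    rw [iteratedFDeriv_two_apply, ← hFdef] at this
    simpa using this
  set W : Set E := (fun p : (ℝ × ℝ) × E × E => p.1.1 • p.2.1 + p.1.2 • p.2.2) ''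
    (({0}ᶜ : Set (ℝ × ℝ)) ×ˢ (Metric.ball v₀ ε ×ˢ Metric.ball w₀ ε)) with hW
  have hWmem : ∀ x, x ∈ W ↔ ∃ X : ℝ × ℝ, X ≠ 0 ∧ ∃ v w, ‖v - v₀‖ < ε ∧ ‖w - w₀‖ < ε ∧
      iota v w X = x := by
    intro x
    constructor
    · rintro ⟨⟨X, v, w⟩, ⟨hX, hv, hw⟩, rfl⟩
      exact ⟨X, hX, v, w, by simpa [dist_eq_norm] using hv, by simpa [dist_eq_norm] using hw,
        iota_apply v w X⟩
    · rintro ⟨X, hX, v, w, hv, hw, rfl⟩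
      exact ⟨⟨X, v, w⟩, ⟨hX, by simpa [dist_eq_norm] using hv, by simpa [dist_eq_norm] using hw⟩,
        (iota_apply v w X).symm⟩
  have hWne : ∀ x ∈ W, x ≠ 0 := by
    intro x hx
    obtain ⟨X, hX, v, w, hv, hw, rfl⟩ := (hWmem x).1 hx
    exact hLI v w hv hw X hX
  have hWconn : IsPreconnected W := by
    refine IsPreconnected.image ?_ _ (by fun_prop)
    exact conn2.isPreconnected.prod ((convex_ball v₀ ε).isPreconnected.prod
      (convex_ball w₀ ε).isPreconnected)
  have hWopen : IsOpen W := by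
    rw [isOpen_iff_mem_nhds]
    intro x hx
    obtain ⟨X, hX, v, w, hv, hw, rfl⟩ := (hWmem x).1 hx
    have hr := r_pos X hX
    set x := iota v w X with hxdef
    have c1 : ContinuousAt (fun z : E => ‖v + (X.1 / (X.1 ^ 2 + X.2 ^ 2)) • (z - x) - v₀‖) x := by
      fun_prop
    have c2 : ContinuousAt (fun z : E => ‖w + (X.2 / (X.1 ^ 2 + X.2 ^ 2)) • (z - x) - w₀‖) x := by
      fun_prop
    filter_upwards [c1.eventually_lt_const (by simpa using hv : _ < ε),
      c2.eventually_lt_const (by simpa using hw : _ < ε)] with z h1 h2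
    refine (hWmem z).2 ⟨X, hX, _, _, h1, h2, ?_⟩
    have e1 : iota (v + (X.1 / (X.1 ^ 2 + X.2 ^ 2)) • (z - x)) (w + (X.2 / (X.1 ^ 2 + X.2 ^ 2)) • (z - x)) X
        = iota v w X + (X.1 * (X.1 / (X.1 ^ 2 + X.2 ^ 2)) + X.2 * (X.2 / (X.1 ^ 2 + X.2 ^ 2))) • (z - x) := by
      simp only [iota_apply]; module
    have e2 : X.1 * (X.1 / (X.1 ^ 2 + X.2 ^ 2)) + X.2 * (X.2 / (X.1 ^ 2 + X.2 ^ 2)) = 1 := by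
      field_simp
    rw [e1, e2, one_smul, ← hxdef]; abel
  have hmem0 : ∀ X, X ≠ 0 → iota v₀ w₀ X ∈ W := fun X hX =>
    (hWmem _).2 ⟨X, hX, v₀, w₀, by simpa, by simpa, rfl⟩
  set x0 := iota v₀ w₀ (1, 0) with hx0
  have hx0W : x0 ∈ W := hmem0 _ (by simp)
  have hconst : ∀ x ∈ W, fderiv ℝ (fderiv ℝ F) x = fderiv ℝ (fderiv ℝ F) x0 := by
    intro x hx
    refine hWopen.is_const_of_fderiv_eq_zero (𝕜 := ℝ) hWconn
      (fun z hz => (df2 F hF z (hWne z hz)).differentiableWithinAt) ?_ hx hx0W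
    intro z hz
    obtain ⟨X, hX, v, w, hv, hw, rfl⟩ := (hWmem z).1 hz
    exact hD3 v w hv hw X hX
  obtain ⟨g, hg⟩ : ∃ g, g = fderiv ℝ (fderiv ℝ F) x0 := ⟨_, rfl⟩
  let Bf : LinearMap.BilinMap ℝ E ℝ := LinearMap.mk₂ ℝ (fun a b => (1 / 2 : ℝ) * g a b)
    (by intro a b c; simp; ring) (by intro a b c; simp; ring) (by intro a b c; simp; ring)
    (by intro a b c; simp; ring)
  have hQ : ∀ u, Bf.toQuadraticMap u = (1 / 2 : ℝ) * g u u := by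
    intro u; simp [Bf]
  refine ⟨Bf.toQuadraticMap, ?_, W, hWopen, hmem0, ?_⟩
  · intro u hu
    rw [hQ, hg]
    have := hgp x0 (hWne x0 hx0W) u hu
    positivity
  · intro u hu
    rw [hQ, hg, ← hconst u hu, euler2 F hF hFh u (hWne u hu), euler1 F hF hFh u (hWne u hu), hFdef]
    ring

theorem statement0 (n : ℕ) (hn : 3 ≤ n)
    (Φ : EuclideanSpace ℝ (Fin n) → ℝ) (hΦ : IsBanachMinkowski Φ)
    (B : Set (EuclideanSpace ℝ (Fin n))) (hB : B = {u | Φ u ≤ 1})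
    (v₀ w₀ : EuclideanSpace ℝ (Fin n)) (hvw : LinearIndependent ℝ ![v₀, w₀])
    (H : Submodule ℝ (EuclideanSpace ℝ (Fin n)))
    (hH : H = Submodule.span ℝ {v₀, w₀})
    (ε : ℝ) (hε : 0 < ε)
    (hsec : ∀ v w : EuclideanSpace ℝ (Fin n), LinearIndependent ℝ ![v, w] →
      ‖v - v₀‖ < ε → ‖w - w₀‖ < ε →
      ∃ A : H ≃ₗ[ℝ] (Submodule.span ℝ {v, w} : Submodule ℝ (EuclideanSpace ℝ (Fin n))),
        ∀ u : H, ((u : EuclideanSpace ℝ (Fin n)) ∈ B ↔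
          ((A u : Submodule.span ℝ {v, w}) : EuclideanSpace ℝ (Fin n)) ∈ B)) :
    ∃ Q : QuadraticForm ℝ (EuclideanSpace ℝ (Fin n)), Q.PosDef ∧
      ∃ W : Set (EuclideanSpace ℝ (Fin n)), IsOpen W ∧
        (H : Set (EuclideanSpace ℝ (Fin n))) \ {0} ⊆ W ∧
        (∀ u ∈ W, Φ u ^ 2 = Q u) ∧
        (∀ u ∈ (H : Set (EuclideanSpace ℝ (Fin n))), (u ∈ B ↔ Q u ≤ 1)) := by
  have hΦ' := hΦ
  obtain ⟨h0, hpos, hhom, hsub, hsm, hconv⟩ := hΦ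
  have hnn : ∀ u, 0 ≤ Φ u := fun u => by
    by_cases hu : u = 0
    · rw [hu, h0]
    · exact (hpos u hu).le
  obtain ⟨δ, hδ, hnear⟩ := near_LI v₀ w₀ hvw
  have hLI : ∀ v w : EuclideanSpace ℝ (Fin n), ‖v - v₀‖ < min ε δ → ‖w - w₀‖ < min ε δ →
      ∀ X, X ≠ 0 → iota v w X ≠ 0 := fun v w hv hw =>
    iota_ne v w (hnear v w (hv.trans_le (min_le_right _ _)) (hw.trans_le (min_le_right _ _)))
  have hL : ∀ v w : EuclideanSpace ℝ (Fin n), ‖v - v₀‖ < min ε δ → ‖w - w₀‖ < min ε δ →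
      ∃ L : (ℝ × ℝ) ≃ₗ[ℝ] H, ∀ X, Φ (L X) = Φ (iota v w X) := by
    intro v w hv hw
    obtain ⟨A, hA⟩ := hsec v w
      (hnear v w (hv.trans_le (min_le_right _ _)) (hw.trans_le (min_le_right _ _)))
      (hv.trans_le (min_le_left _ _)) (hw.trans_le (min_le_left _ _))
    obtain ⟨J, hJ⟩ := exists_coord v w (hLI v w hv hw)
    have hA' : ∀ u : H, Φ u ≤ 1 ↔ Φ (A u) ≤ 1 := by
      intro u
      have := hA u
      rw [hB] at this
      exact this
    have hAe : ∀ u : H, Φ u = Φ (A u) := by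
      intro u
      refine le_antisymm ?_ ?_
      · exact hom_le (fun u : H => Φ u) (fun u : H => Φ (A u))
          (fun t ht u => by simp [hhom t ht]) (fun t ht u => by simp [hhom t ht])
          (fun _ => hnn _) (fun u => (hA' u).2) u
      · exact hom_le (fun u : H => Φ (A u)) (fun u : H => Φ u)
          (fun t ht u => by simp [hhom t ht]) (fun t ht u => by simp [hhom t ht])
          (fun _ => hnn _) (fun u => (hA' u).1) u
    refine ⟨J.trans A.symm, fun X => ?_⟩
    rw [hAe, LinearEquiv.trans_apply, LinearEquiv.apply_symm_apply, hJ]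
  have hEq : ∀ v w v' w' : EuclideanSpace ℝ (Fin n), ‖v - v₀‖ < min ε δ → ‖w - w₀‖ < min ε δ →
      ‖v' - v₀‖ < min ε δ → ‖w' - w₀‖ < min ε δ →
      ∃ M : ℝ × ℝ →L[ℝ] ℝ × ℝ, ∀ X, Φ (iota v' w' X) = Φ (iota v w (M X)) := by
    intro v w v' w' hv hw hv' hw'
    obtain ⟨L, hL1⟩ := hL v w hv hw
    obtain ⟨L', hL1'⟩ := hL v' w' hv' hw'
    refine ⟨LinearMap.toContinuousLinearMap ((L'.trans L.symm : (ℝ × ℝ) ≃ₗ[ℝ] (ℝ × ℝ)) :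
      (ℝ × ℝ) →ₗ[ℝ] (ℝ × ℝ)), fun X => ?_⟩
    rw [← hL1, ← hL1']
    simp
  obtain ⟨Q, hQ, W, hWo, hWm, hWQ⟩ := final_lemma (by simpa using hn) Φ hΦ' v₀ w₀ (min ε δ)
    (lt_min hε hδ) hLI hEq
  have hHW : (H : Set (EuclideanSpace ℝ (Fin n))) \ {0} ⊆ W := by
    rintro u ⟨hu, hu0⟩
    have hu : u ∈ H := hu
    rw [hH] at hu
    obtain ⟨a, b, rfl⟩ := Submodule.mem_span_pair.1 hu
    rw [show a • v₀ + b • w₀ = iota v₀ w₀ (a, b) from (iota_apply v₀ w₀ (a, b)).symm]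
    apply hWm
    intro h
    apply hu0
    rw [Prod.ext_iff] at h
    simp only [Prod.fst_zero, Prod.snd_zero] at h
    simp [h.1, h.2]
  refine ⟨Q, hQ, W, hWo, hHW, hWQ, fun u hu => ?_⟩
  have hm : u ∈ B ↔ Φ u ≤ 1 := by rw [hB]; rfl
  rw [hm]
  by_cases hu0 : u = 0
  · simp [hu0, h0]
  · rw [← hWQ u (hHW ⟨hu, hu0⟩), sq_le_one_iff₀ (hnn u)]
end
end

section
/- Let V be a real vector space of dimension n ≥ 3 and Φ a Banach–Minkowski norm on V. Let P be a nonempty connected open subset of {(v,w) ∈ V × V : v, w linearly independent} such that for all (v,w), (v',w') ∈ P there is a linear bijection A : span{v,w} → span{v',w'} with Φ(A(u)) = Φ(u) for all u ∈ span{v,w}. Then there exists a positive definite quadratic form Q on V such that Φ(u)² = Q(u) for every u lying in span{v,w} for some (v,w) ∈ P; in particular the restriction of Φ to each such plane is a Euclidean norm. -/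
noncomputable section

open Set Filter Topology
open scoped ContDiff


structure HypF {V : Type*} [NormedAddCommGroup V] [NormedSpace ℝ V] (F : V → ℝ) : Prop where
  pos : ∀ v, v ≠ 0 → 0 < F v
  hom : ∀ t : ℝ, 0 ≤ t → ∀ v, F (t • v) = t ^ 2 * F v
  smooth : ∀ v, v ≠ 0 → ContDiffAt ℝ (⊤ : ℕ∞) F v

section
variable {V W : Type*} [NormedAddCommGroup V] [NormedSpace ℝ V]
  [NormedAddCommGroup W] [NormedSpace ℝ W]

lemma euler_gen (g : V → W) (k : ℕ) (u : V) (hg : DifferentiableAt ℝ g u)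
    (h : ∀ t : ℝ, 0 < t → g (t • u) = t ^ k • g u) : fderiv ℝ g u u = (k : ℝ) • g u := by
  have h1 : HasDerivAt (fun t : ℝ => g (t • u)) (fderiv ℝ g u u) 1 := by
    have h2 : HasDerivAt (fun t : ℝ => t • u) u 1 := by
      simpa using (hasDerivAt_id (1:ℝ)).smul_const u
    have h3 : HasFDerivAt g (fderiv ℝ g u) ((fun t : ℝ => t • u) 1) := by
      simpa using hg.hasFDerivAt
    exact h3.comp_hasDerivAt (1:ℝ) h2
  have h4 : HasDerivAt (fun t : ℝ => t ^ k • g u) ((k : ℝ) • g u) 1 := by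
    simpa using (hasDerivAt_pow k (1:ℝ)).smul_const (g u)
  refine h1.unique (h4.congr_of_eventuallyEq ?_)
  filter_upwards [lt_mem_nhds (zero_lt_one (α := ℝ))] with t ht using h t ht

lemma fderiv_hom (g : V → W) (k : ℕ)
    (h : ∀ t : ℝ, 0 < t → ∀ u, u ≠ 0 → g (t • u) = t ^ (k+1) • g u) (t : ℝ) (ht : 0 < t) (u : V)
    (hu : u ≠ 0) (hg : DifferentiableAt ℝ g u) :
    fderiv ℝ g (t • u) = t ^ k • fderiv ℝ g u := by
  have h1 : fderiv ℝ (fun v => g (t • v)) u = t • fderiv ℝ g (t • u) := fderiv_comp_smul ..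
  have h2 : fderiv ℝ (fun v => g (t • v)) u = t ^ (k+1) • fderiv ℝ g u := by
    rw [← fderiv_fun_const_smul hg]
    apply Filter.EventuallyEq.fderiv_eq
    filter_upwards [isOpen_ne.mem_nhds hu] with v hv using h t ht v hv
  rw [h1] at h2
  have : t⁻¹ • (t • fderiv ℝ g (t • u)) = t⁻¹ • (t ^ (k+1) • fderiv ℝ g u) := by rw [h2]
  rwa [smul_smul, smul_smul, inv_mul_cancel₀ ht.ne', one_smul, pow_succ', inv_mul_cancel_left₀ ht.ne'] at this

variable {F : V → ℝ}

lemma HypF.zero (hF : HypF F) : F 0 = 0 := by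
  have := hF.hom 0 le_rfl 0
  simpa using this

lemma HypF.s1 (hF : HypF F) (u : V) (hu : u ≠ 0) : ContDiffAt ℝ (⊤ : ℕ∞) (fderiv ℝ F) u :=
  (hF.smooth u hu).fderiv_right (by simp)
lemma HypF.s2 (hF : HypF F) (u : V) (hu : u ≠ 0) :
    ContDiffAt ℝ (⊤ : ℕ∞) (fderiv ℝ (fderiv ℝ F)) u :=
  (hF.s1 u hu).fderiv_right (by simp)
lemma HypF.d0 (hF : HypF F) (u : V) (hu : u ≠ 0) : DifferentiableAt ℝ F u :=
  (hF.smooth u hu).differentiableAt (by simp)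
lemma HypF.d1 (hF : HypF F) (u : V) (hu : u ≠ 0) : DifferentiableAt ℝ (fderiv ℝ F) u :=
  (hF.s1 u hu).differentiableAt (by simp)
lemma HypF.d2 (hF : HypF F) (u : V) (hu : u ≠ 0) :
    DifferentiableAt ℝ (fderiv ℝ (fderiv ℝ F)) u :=
  (hF.s2 u hu).differentiableAt (by simp)

lemma HypF.e0 (hF : HypF F) (u : V) (hu : u ≠ 0) : fderiv ℝ F u u = 2 * F u := by
  simpa using euler_gen F 2 u (hF.d0 u hu) (fun t ht => hF.hom t ht.le u)

lemma HypF.h1 (hF : HypF F) (t : ℝ) (ht : 0 < t) (u : V) (hu : u ≠ 0) :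
    fderiv ℝ F (t • u) = t ^ 1 • fderiv ℝ F u :=
  fderiv_hom F 1 (fun t ht u _ => hF.hom t ht.le u) t ht u hu (hF.d0 u hu)

lemma HypF.h2 (hF : HypF F) (t : ℝ) (ht : 0 < t) (u : V) (hu : u ≠ 0) :
    fderiv ℝ (fderiv ℝ F) (t • u) = t ^ 0 • fderiv ℝ (fderiv ℝ F) u :=
  fderiv_hom (fderiv ℝ F) 0 (fun t ht u hu => hF.h1 t ht u hu) t ht u hu (hF.d1 u hu)

lemma HypF.e1 (hF : HypF F) (u : V) (hu : u ≠ 0) :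
    fderiv ℝ (fderiv ℝ F) u u = fderiv ℝ F u := by
  simpa using euler_gen (fderiv ℝ F) 1 u (hF.d1 u hu) (fun t ht => hF.h1 t ht u hu)

lemma HypF.e2 (hF : HypF F) (u : V) (hu : u ≠ 0) :
    fderiv ℝ (fderiv ℝ (fderiv ℝ F)) u u = 0 := by
  simpa using euler_gen (fderiv ℝ (fderiv ℝ F)) 0 u (hF.d2 u hu) (fun t ht => hF.h2 t ht u hu)

lemma HypF.sym2 (hF : HypF F) (u : V) (hu : u ≠ 0) (x y : V) :
    fderiv ℝ (fderiv ℝ F) u x y = fderiv ℝ (fderiv ℝ F) u y x :=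
  ((hF.smooth u hu).isSymmSndFDerivAt (by simpa using WithTop.coe_le_coe.2 (le_top : (2:ℕ∞) ≤ ⊤))).eq x y

lemma HypF.sym3a (hF : HypF F) (u : V) (hu : u ≠ 0) (x y : V) :
    fderiv ℝ (fderiv ℝ (fderiv ℝ F)) u x y = fderiv ℝ (fderiv ℝ (fderiv ℝ F)) u y x :=
  ((hF.s1 u hu).isSymmSndFDerivAt (by simpa using WithTop.coe_le_coe.2 (le_top : (2:ℕ∞) ≤ ⊤))).eq x y

lemma HypF.sym3b (hF : HypF F) (u : V) (hu : u ≠ 0) (x y z : V) :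
    fderiv ℝ (fderiv ℝ (fderiv ℝ F)) u x y z = fderiv ℝ (fderiv ℝ (fderiv ℝ F)) u x z y := by
  have h : ∀ y z, HasFDerivAt (fun v => fderiv ℝ (fderiv ℝ F) v y z)
      ((fderiv ℝ (fderiv ℝ (fderiv ℝ F)) u).flip y |>.flip z) u := by
    intro y z
    have := ((hF.d2 u hu).hasFDerivAt.clm_apply (hasFDerivAt_const y u)).clm_apply
      (hasFDerivAt_const z u)
    simpa using this
  have h2 := (h z y).congr_of_eventuallyEq (f₁ := fun v => fderiv ℝ (fderiv ℝ F) v y z) (by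
    filter_upwards [isOpen_ne.mem_nhds hu] with v hv using hF.sym2 v hv y z)
  have := congrArg (fun T => T x) ((h y z).unique h2)
  simpa using this

lemma HypF.bounds [FiniteDimensional ℝ V] [Nontrivial V] (hF : HypF F) :
    ∃ c > 0, ∃ C > 0, ∀ u, c * ‖u‖ ^ 2 ≤ F u ∧ F u ≤ C * ‖u‖ ^ 2 := by
  have hc : ContinuousOn F (Metric.sphere 0 1) := by
    intro u hu
    have : u ≠ 0 := by rintro rfl; simp at hu
    exact (hF.smooth u this).continuousAt.continuousWithinAt
  have hk := isCompact_sphere (0 : V) 1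
  have hne : (Metric.sphere (0 : V) 1).Nonempty := NormedSpace.sphere_nonempty.2 zero_le_one
  obtain ⟨a, ha, ha'⟩ := hk.exists_isMinOn hne hc
  obtain ⟨b, hb, hb'⟩ := hk.exists_isMaxOn hne hc
  have n0 : ∀ u ∈ Metric.sphere (0 : V) 1, u ≠ 0 := by
    rintro u hu rfl; simp at hu
  refine ⟨F a, hF.pos a (n0 a ha), F b, hF.pos b (n0 b hb), fun u => ?_⟩
  by_cases hu : u = 0
  · subst hu; simp [hF.zero]
  have hn : 0 < ‖u‖ := norm_pos_iff.2 hu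
  have hs : ‖u‖⁻¹ • u ∈ Metric.sphere (0 : V) 1 := by
    simp [norm_smul, hn.ne']
  have he : F u = ‖u‖ ^ 2 * F (‖u‖⁻¹ • u) := by
    rw [← hF.hom _ hn.le, smul_smul, mul_inv_cancel₀ hn.ne', one_smul]
  rw [he, mul_comm (F a), mul_comm (F b)]
  exact ⟨mul_le_mul_of_nonneg_left (ha' hs) (by positivity),
    mul_le_mul_of_nonneg_left (hb' hs) (by positivity)⟩

lemma HypF.cont [FiniteDimensional ℝ V] [Nontrivial V] (hF : HypF F) : Continuous F := by
  rw [continuous_iff_continuousAt]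
  intro u
  by_cases hu : u = 0
  · subst hu
    obtain ⟨c, hc, C, hC, h⟩ := hF.bounds
    unfold ContinuousAt
    rw [hF.zero]
    refine squeeze_zero (g := fun u => C * ‖u‖ ^ 2) (fun u => (by positivity : 0 ≤ c * ‖u‖^2).trans (h u).1) (fun u => (h u).2) ?_
    have : Continuous fun u : V => C * ‖u‖ ^ 2 := by fun_prop
    simpa using this.tendsto 0
  · exact (hF.smooth u hu).continuousAt
end

section
variable {V W : Type*} [NormedAddCommGroup V] [NormedSpace ℝ V]
variable {F : V → ℝ}

lemma HypF.const_along (hF : HypF F) (γ γ' : ℝ → V) (h : ∀ t, HasDerivAt γ (γ' t) t)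
    (h0 : ∀ t, γ t ≠ 0) (hd : ∀ t, fderiv ℝ F (γ t) (γ' t) = 0) (s t : ℝ) :
    F (γ s) = F (γ t) := by
  have H : ∀ t, HasDerivAt (fun t => F (γ t)) 0 t := by
    intro t
    have := (hF.d0 _ (h0 t)).hasFDerivAt.comp_hasDerivAt t (h t)
    rwa [hd t] at this
  exact is_const_of_deriv_eq_zero (fun t => (H t).differentiableAt) (fun t => (H t).deriv) s t

lemma HypF.kill0 (hF : HypF F) (a b : V) (τ d : ℝ)
    (hab : ∀ x y : ℝ, x • a + y • b = 0 → x = 0 ∧ y = 0)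
    (H : ∀ x y : ℝ, x • a + y • b ≠ 0 →
      fderiv ℝ F (x • a + y • b) (x • b + y • (τ • b - d • a)) = 0) :
    ∃ A B C : ℝ, ∀ x y : ℝ, F (x • a + y • b) = A * x ^ 2 + B * x * y + C * y ^ 2 := by
  have ha : a ≠ 0 := by
    rintro rfl
    have := (hab 1 0 (by simp)).1
    simp at this
  have hb : b ≠ 0 := by
    rintro rfl
    have := (hab 0 1 (by simp)).2
    simp at this
  by_cases hdisc : 0 ≤ τ ^ 2 - 4 * d
  · exfalso
    have key : ∀ s1 s2 : ℝ, s1 + s2 = τ → s1 * s2 = d → s1 = 0 := by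
      intro s1 s2 h1 h2
      have hz : (-s2) • a + (1:ℝ) • b ≠ 0 := fun h => by
        have := (hab _ _ h).2; simp at this
      have := H _ _ hz
      have e : (-s2) • b + (1:ℝ) • (τ • b - d • a) = s1 • ((-s2) • a + (1:ℝ) • b) := by
        subst h1 h2; module
      rw [e, map_smul, hF.e0 _ hz] at this
      have hp := hF.pos _ hz
      simp only [smul_eq_mul, mul_eq_zero] at this
      rcases this with h | h | h
      · exact h
      · norm_num at h
      · exact absurd h hp.ne'
    have hs := Real.sq_sqrt hdisc
    set r := √(τ ^ 2 - 4 * d)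
    have h1 := key ((τ + r) / 2) ((τ - r) / 2) (by ring) (by nlinarith)
    have h2 := key ((τ - r) / 2) ((τ + r) / 2) (by ring) (by nlinarith)
    have hτ : τ = 0 := by linarith
    have hr : r = 0 := by linarith
    have hd : d = 0 := by rw [hτ, hr] at hs; linarith
    subst hτ hd
    have hc : ∀ t : ℝ, F (a + t • b) = F a := by
      intro t
      have := hF.const_along (fun t => a + t • b) (fun _ => b) (fun t => by
        simpa using ((hasDerivAt_id t).smul_const b).const_add a) (fun t h => by
          have := (hab 1 t (by simpa using h)).1; simp at this) (fun t => by
          have := H 1 t (fun h => by have := (hab 1 t h).1; simp at this)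
          simpa using this) t 0
      simpa using this
    have hlim : Tendsto (fun s : ℝ => F (b + s • a)) (𝓝[>] 0) (𝓝 (F b)) := by
      have h1 : ContinuousAt F (b + (0:ℝ) • a) := by
        simpa using (hF.d0 b hb).continuousAt
      have h2 : ContinuousAt (fun s : ℝ => F (b + s • a)) 0 :=
        ContinuousAt.comp (f := fun s : ℝ => b + s • a) h1 (by fun_prop)
      have h3 := h2.tendsto
      simp only [zero_smul, add_zero] at h3
      exact h3.mono_left nhdsWithin_le_nhds
    have hlim2 : Tendsto (fun s : ℝ => F (b + s • a)) (𝓝[>] 0) (𝓝 0) := by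
      have : Tendsto (fun s : ℝ => s ^ 2 * F a) (𝓝[>] 0) (𝓝 0) := by
        have : Continuous (fun s : ℝ => s ^ 2 * F a) := by fun_prop
        have := this.tendsto 0
        simp only [ne_eq, OfNat.ofNat_ne_zero, not_false_eq_true, zero_pow, zero_mul] at this
        exact this.mono_left nhdsWithin_le_nhds
      refine this.congr' ?_
      filter_upwards [self_mem_nhdsWithin] with s hs
      have hs : 0 < s := hs
      rw [← hc s⁻¹, ← hF.hom s hs.le, smul_add, smul_smul, mul_inv_cancel₀ hs.ne', one_smul, add_comm]
    have := tendsto_nhds_unique hlim hlim2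
    exact (hF.pos b hb).ne' this
  · push Not at hdisc
    have hpos : 0 < d - τ ^ 2 / 4 := by linarith
    obtain ⟨om, hom, hom2⟩ : ∃ om : ℝ, 0 < om ∧ om ^ 2 = d - τ ^ 2 / 4 :=
      ⟨_, Real.sqrt_pos.2 hpos, Real.sq_sqrt hpos.le⟩
    obtain ⟨α, rfl⟩ : ∃ α, τ = 2 * α := ⟨τ / 2, by ring⟩
    have hd : d = om ^ 2 + α ^ 2 := by rw [hom2]; ring
    subst hd
    clear hom2 hpos hdisc
    let Xc : ℝ → ℝ := fun t => Real.exp (α * t) * (Real.cos (om * t) - α / om * Real.sin (om * t))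
    let Yc : ℝ → ℝ := fun t => Real.exp (α * t) * (Real.sin (om * t) / om)
    have he : ∀ t, HasDerivAt (fun t => Real.exp (α * t)) (Real.exp (α * t) * α) t := fun t => by
      simpa using ((hasDerivAt_id t).const_mul α).exp
    have hcos : ∀ t, HasDerivAt (fun t => Real.cos (om * t)) (-Real.sin (om * t) * om) t := fun t => by
      simpa using ((hasDerivAt_id t).const_mul om).cos
    have hsin : ∀ t, HasDerivAt (fun t => Real.sin (om * t)) (Real.cos (om * t) * om) t := fun t => by
      simpa using ((hasDerivAt_id t).const_mul om).sin
    have hX : ∀ t, HasDerivAt Xc (-(om ^ 2 + α ^ 2) * Yc t) t := fun t => by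
      refine ((he t).mul ((hcos t).sub ((hsin t).const_mul (α / om)))).congr_deriv ?_
      simp only [Yc, Pi.sub_apply]; field_simp; ring
    have hY : ∀ t, HasDerivAt Yc (Xc t + 2 * α * Yc t) t := fun t => by
      refine ((he t).mul ((hsin t).div_const om)).congr_deriv ?_
      simp only [Xc, Yc]; field_simp; ring
    have hne : ∀ t, Xc t • a + Yc t • b ≠ 0 := by
      intro t h
      obtain ⟨h1, h2⟩ := hab _ _ h
      have hex := (Real.exp_pos (α * t)).ne'
      simp only [Xc, Yc, mul_eq_zero, hex, false_or, div_eq_zero_iff, hom.ne', or_false] at h1 h2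
      rw [h2] at h1
      have := Real.sin_sq_add_cos_sq (om * t)
      simp only [mul_zero, sub_zero] at h1
      rw [h1, h2] at this
      norm_num at this
    have hconst := hF.const_along (fun t => Xc t • a + Yc t • b) _
      (fun t => ((hX t).smul_const a).add ((hY t).smul_const b)) hne (fun t => by
        have := H _ _ (hne t)
        convert this using 2
        module)
    have hα : α = 0 := by
      have := hconst (2 * Real.pi / om) 0
      have e : om * (2 * Real.pi / om) = 2 * Real.pi := by field_simp
      simp only [Xc, Yc, e, Real.cos_two_pi, Real.sin_two_pi] at this
      simp only [mul_zero, sub_zero, mul_one, zero_div, zero_smul, add_zero, Real.exp_zero, Real.cos_zero, Real.sin_zero, one_smul] at this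
      rw [hF.hom _ (Real.exp_pos _).le, ← Real.exp_nat_mul] at this
      have hFa := hF.pos a ha
      have h1 : Real.exp ((2:ℕ) * (α * (2 * Real.pi / om))) = 1 := by
        have : (Real.exp ((2:ℕ) * (α * (2 * Real.pi / om))) - 1) * F a = 0 := by linarith
        rcases mul_eq_zero.1 this with h | h
        · linarith
        · exact absurd h hFa.ne'
      rw [Real.exp_eq_one_iff] at h1
      have := Real.pi_pos
      simp only [mul_eq_zero, div_eq_zero_iff, this.ne', hom.ne'] at h1
      norm_num at h1
      exact h1
    subst hα
    have hrot : ∀ t, F (Real.cos (om * t) • a + (Real.sin (om * t) / om) • b) = F a := by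
      intro t
      have := hconst t 0
      simpa [Xc, Yc] using this
    refine ⟨F a, 0, F a * om ^ 2, fun x y => ?_⟩
    -- polar coordinates
    let z : ℂ := ⟨x, om * y⟩
    have hx : ‖z‖ * Real.cos (Complex.arg z) = x := Complex.norm_mul_cos_arg z
    have hy : ‖z‖ * Real.sin (Complex.arg z) = om * y := Complex.norm_mul_sin_arg z
    have hn : ‖z‖ ^ 2 = x ^ 2 + (om * y) ^ 2 := by
      rw [← hx, ← hy]
      have := Real.sin_sq_add_cos_sq (Complex.arg z)
      linear_combination (-‖z‖^2) * this
    have h1 := hrot (Complex.arg z / om)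
    rw [mul_div_cancel₀ _ hom.ne'] at h1
    have h2 := hF.hom ‖z‖ (norm_nonneg _) (Real.cos (Complex.arg z) • a + (Real.sin (Complex.arg z) / om) • b)
    rw [h1, smul_add, smul_smul, smul_smul, hx, mul_div_assoc', hy, mul_div_cancel_left₀ _ hom.ne', hn] at h2
    rw [h2]; ring

/-- quadratic along lines in X -/
def Euc (F : V → ℝ) (X : Submodule ℝ V) : Prop :=
  ∀ u ∈ X, ∀ x ∈ X, ∃ α β γ : ℝ, ∀ t : ℝ, F (u + t • x) = α + β * t + γ * t ^ 2

lemma HypF.kill (hF : HypF F) (X : Submodule ℝ V) (hX : Module.finrank ℝ X = 2)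
    (L : X →ₗ[ℝ] X) (hL : L ≠ 0) (H : ∀ u : X, u ≠ 0 → fderiv ℝ F u (L u : X) = 0) :
    Euc F X := by
  have : FiniteDimensional ℝ X := Module.finite_of_finrank_pos (by omega)
  obtain ⟨a, ha⟩ : ∃ a, L a ≠ 0 := by
    by_contra! h
    exact hL (LinearMap.ext h)
  have ha0 : a ≠ 0 := by rintro rfl; simp at ha
  have hab : LinearIndependent ℝ ![a, L a] := by
    rw [LinearIndependent.pair_iff' ha0]
    intro s hs
    have h1 := H a ha0
    have ha0' : (a : V) ≠ 0 := by simpa using ha0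
    rw [← hs, Submodule.coe_smul, map_smul, hF.e0 _ ha0', smul_eq_mul] at h1
    have hp := hF.pos _ ha0'
    have : s = 0 := by
      rcases mul_eq_zero.1 h1 with h | h
      · exact h
      · linarith
    rw [this, zero_smul] at hs
    exact ha hs.symm
  have hspan : ∀ u : X, ∃ x y : ℝ, x • a + y • L a = u := by
    intro u
    have h := hab.span_eq_top_of_card_eq_finrank' (by simp [hX])
    have hu : u ∈ Submodule.span ℝ (Set.range ![a, L a]) := by rw [h]; trivial
    simp only [Matrix.range_cons, Matrix.range_empty, Set.union_empty, Set.singleton_union] at hu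
    exact Submodule.mem_span_pair.1 hu
  obtain ⟨d', τ, hdt⟩ := hspan (L (L a))
  have hind := LinearIndependent.pair_iff.1 hab
  obtain ⟨A, B, C, hABC⟩ := hF.kill0 (a : V) (L a : X) τ (-d') (fun x y h => by
    apply hind x y
    ext
    simpa using h) (fun x y h => by
      have h1 := H (x • a + y • L a) (fun h' => h (by simpa using congrArg Subtype.val h'))
      rw [map_add, map_smul, map_smul, ← hdt] at h1
      push_cast at h1
      convert h1 using 2
      module)
  intro u hu x hx
  obtain ⟨u1, u2, h1⟩ := hspan ⟨u, hu⟩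
  obtain ⟨x1, x2, h2⟩ := hspan ⟨x, hx⟩
  have h1 := congrArg Subtype.val h1
  have h2 := congrArg Subtype.val h2
  simp at h1 h2
  refine ⟨A * u1 ^ 2 + B * u1 * u2 + C * u2 ^ 2, 2 * A * u1 * x1 + B * (u1 * x2 + x1 * u2) + 2 * C * u2 * x2,
    A * x1 ^ 2 + B * x1 * x2 + C * x2 ^ 2, fun t => ?_⟩
  have : u + t • x = (u1 + t * x1) • (a : V) + (u2 + t * x2) • ((L a : X) : V) := by
    rw [← h1, ← h2]; module
  rw [this, hABC]; ring
end

section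
variable {V W : Type*} [NormedAddCommGroup V] [NormedSpace ℝ V]
variable {F : V → ℝ}

lemma seq_norm {Z : Type*} [NormedAddCommGroup Z] [NormedSpace ℝ Z] [FiniteDimensional ℝ Z]
    (w : ℕ → Z) (hw0 : ∀ n, w n ≠ 0) : ∃ r : ℕ → ℝ, ∃ z : Z, z ≠ 0 ∧ ∃ ψ : ℕ → ℕ, StrictMono ψ ∧
      Tendsto (fun n => r (ψ n) • w (ψ n)) atTop (𝓝 z) := by
  have : ProperSpace Z := FiniteDimensional.proper ℝ Z
  obtain ⟨z, hz, ψ, hψ, hlim⟩ := (isCompact_sphere (0 : Z) 1).tendsto_subseq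
    (x := fun n => ‖w n‖⁻¹ • w n) (fun n => by
      have := norm_ne_zero_iff.2 (hw0 n)
      simp [norm_smul, this])
  exact ⟨fun n => ‖w n‖⁻¹, z, by rintro rfl; simp at hz, ψ, hψ, hlim⟩

lemma HypF.dich [FiniteDimensional ℝ V] (hF : HypF F) (X : Submodule ℝ V)
    (hX : Module.finrank ℝ X = 2) (e : V) (l : X →ₗ[ℝ] ℝ)
    (hB : ∀ᶠ ε in 𝓝[>] (0:ℝ), ∃ B : X →ₗ[ℝ] X, ∀ u : X, F (B u : X) = F (u + (ε * l u) • e)) :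
    Euc F X ∨ ∃ b : X →ₗ[ℝ] X, ∀ u : X, u ≠ 0 → l u * fderiv ℝ F u e = fderiv ℝ F u (b u : X) := by
  have : Nontrivial X := Module.nontrivial_of_finrank_pos (R := ℝ) (by omega)
  have : Nontrivial V := X.subtype_injective.nontrivial
  obtain ⟨c, hc, C, hC, hcC⟩ := hF.bounds
  have hcont := hF.cont
  have hB' : ∀ᶠ ε in 𝓝[>] (0:ℝ), ∃ B : X →L[ℝ] X, ∀ u : X, F (B u : X) = F (u + (ε * l u) • e) := by
    filter_upwards [hB] with ε ⟨B, h⟩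
    exact ⟨LinearMap.toContinuousLinearMap B, h⟩
  have hsmall : ∀ᶠ ε in 𝓝[>] (0:ℝ), ε ∈ Ioo (0:ℝ) 1 := Ioo_mem_nhdsGT one_pos
  obtain ⟨ε, hε, hε'⟩ := exists_seq_forall_of_frequently (hB'.and hsmall).frequently
  choose B hBu using fun n => (hε' n).1
  have hεI := fun n => (hε' n).2
  have hε0 : Tendsto ε atTop (𝓝 0) := hε.mono_right nhdsWithin_le_nhds
  -- bound
  let lc : X →L[ℝ] ℝ := LinearMap.toContinuousLinearMap l
  let R : ℝ := √(C / c) * (1 + ‖lc‖ * ‖e‖)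
  have hR : 0 ≤ R := by positivity
  have hbd : ∀ n, ‖B n‖ ≤ R := by
    intro n
    refine ContinuousLinearMap.opNorm_le_bound _ hR (fun u => ?_)
    have h1 : c * ‖B n u‖ ^ 2 ≤ C * ‖(u : V) + (ε n * l u) • e‖ ^ 2 := by
      have := (hcC (B n u : X)).1.trans_eq (hBu n u)
      exact this.trans (hcC _).2
    have h2 : ‖(u : V) + (ε n * l u) • e‖ ≤ (1 + ‖lc‖ * ‖e‖) * ‖u‖ := by
      have h3 : ‖l u‖ ≤ ‖lc‖ * ‖u‖ := lc.le_opNorm u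
      have h4 : ‖ε n‖ ≤ 1 := by rw [Real.norm_eq_abs, abs_of_pos (hεI n).1]; exact (hεI n).2.le
      calc _ ≤ ‖(u:V)‖ + ‖(ε n * l u) • e‖ := norm_add_le _ _
        _ = ‖u‖ + ‖ε n‖ * ‖l u‖ * ‖e‖ := by rw [norm_smul, norm_mul]; rfl
        _ ≤ ‖u‖ + 1 * (‖lc‖ * ‖u‖) * ‖e‖ := by gcongr
        _ = _ := by ring
    have h5 : ‖B n u‖ ^ 2 ≤ (R * ‖u‖) ^ 2 := by
      have h6 : (√(C / c)) ^ 2 = C / c := Real.sq_sqrt (by positivity)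
      have h7 : (R * ‖u‖) ^ 2 = C / c * ((1 + ‖lc‖ * ‖e‖) * ‖u‖) ^ 2 := by
        rw [← h6]; simp only [R]; ring
      rw [h7, div_mul_eq_mul_div, le_div_iff₀ hc, mul_comm]
      refine h1.trans ?_
      gcongr
    exact le_of_sq_le_sq h5 (by positivity) 
  have : ProperSpace (X →L[ℝ] X) := FiniteDimensional.proper ℝ (X →L[ℝ] X)
  obtain ⟨B0, -, φ, hφ, hlim⟩ := (isCompact_closedBall (0 : X →L[ℝ] X) R).tendsto_subseq
    (x := B) (fun n => (dist_zero_right (B n)).trans_le (hbd n))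
  have happ : ∀ u : X, Tendsto (fun n => B (φ n) u) atTop (𝓝 (B0 u)) := fun u =>
    ((ContinuousLinearMap.apply ℝ X u).continuous.tendsto B0).comp hlim
  have hB0 : ∀ u : X, F (B0 u : X) = F u := by
    intro u
    have h1 : Tendsto (fun n => F (B (φ n) u : X)) atTop (𝓝 (F (B0 u : X))) :=
      ((hcont.comp continuous_subtype_val).tendsto _).comp (happ u)
    have h2 : Tendsto (fun n => F (B (φ n) u : X)) atTop (𝓝 (F u)) := by
      simp only [hBu]
      have h3 : Continuous fun s : ℝ => F (u + (s * l u) • e) := by fun_prop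
      have := (h3.tendsto 0).comp (hε0.comp hφ.tendsto_atTop)
      simpa [Function.comp_def] using this
    exact tendsto_nhds_unique h1 h2
  have hinj : Function.Injective B0.toLinearMap := by
    rw [← LinearMap.ker_eq_bot, LinearMap.ker_eq_bot']
    intro u hu
    by_contra h
    have h1 := hB0 u
    have h2 : B0 u = 0 := hu
    rw [h2] at h1
    have := hF.pos u (by simpa using h)
    simp [hF.zero] at h1
    linarith
  let S0 := LinearEquiv.ofInjectiveEndo B0.toLinearMap hinj
  let S : X →L[ℝ] X := LinearMap.toContinuousLinearMap S0.symm.toLinearMap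
  have hS1 : ∀ u, S (B0 u) = u := fun u => S0.symm_apply_apply u
  have hS2 : ∀ u, B0 (S u) = u := fun u => S0.apply_symm_apply u
  have hSF : ∀ u : X, F (S u : X) = F u := fun u => by rw [← hB0, hS2]
  let m : ℕ → (X →L[ℝ] X) := fun n => S.comp (B (φ n)) - ContinuousLinearMap.id ℝ X
  have hm : Tendsto m atTop (𝓝 0) := by
    have h1 : Continuous fun T : X →L[ℝ] X => S.comp T - ContinuousLinearMap.id ℝ X := by fun_prop
    have h2 := (h1.tendsto B0).comp hlim
    have h3 : S.comp B0 - ContinuousLinearMap.id ℝ X = 0 := by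
      ext u; simp [hS1]
    rwa [h3] at h2
  let w : ℕ → ℝ × (X →L[ℝ] X) := fun n => (ε (φ n), m n)
  have hw : Tendsto w atTop (𝓝 0) := (hε0.comp hφ.tendsto_atTop).prodMk_nhds hm
  have hw0 : ∀ n, w n ≠ 0 := fun n h => by
    have h1 : ε (φ n) = 0 := congrArg Prod.fst h
    exact (hεI (φ n)).1.ne' h1
  obtain ⟨r, ⟨α, b⟩, hz, ψ, hψ, hlim2⟩ := seq_norm w hw0
  have hla : Tendsto (fun n => r (ψ n) * ε (φ (ψ n))) atTop (𝓝 α) :=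
    (continuous_fst.tendsto _).comp hlim2
  have hlb : Tendsto (fun n => r (ψ n) • m (ψ n)) atTop (𝓝 b) :=
    (continuous_snd.tendsto _).comp hlim2
  have key : ∀ u : X, u ≠ 0 → α * (l u * fderiv ℝ F u e) = fderiv ℝ F u (b u : X) := by
    intro u hu
    have hu' : (u : V) ≠ 0 := by simpa using hu
    have hd := (hF.d0 _ hu').hasFDerivAt.hasFDerivWithinAt (s := univ)
    have l1 := hd.lim (l := atTop) (c := fun n => r (ψ n))
      (d := fun n => (ε (φ (ψ n)) * l u) • e) (v := (α * l u) • e)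
      (by
        have h3 : Continuous fun s : ℝ => (s * l u) • e := by fun_prop
        have := (h3.tendsto 0).comp ((hε0.comp hφ.tendsto_atTop).comp hψ.tendsto_atTop)
        simpa [Function.comp_def] using this) (by simp)
      (by
        have h3 : Continuous fun s : ℝ => (s * l u) • e := by fun_prop
        have := (h3.tendsto α).comp hla
        refine this.congr (fun n => ?_)
        simp [smul_smul, mul_assoc])
    have l2 := hd.lim (l := atTop) (c := fun n => r (ψ n))
      (d := fun n => (m (ψ n) u : X)) (v := (b u : X))
      (by
        have h3 : Continuous fun T : X →L[ℝ] X => ((T u : X) : V) := by fun_prop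
        have := (h3.tendsto 0).comp (hm.comp hψ.tendsto_atTop)
        simpa [Function.comp_def] using this) (by simp)
      (by
        have h3 : Continuous fun T : X →L[ℝ] X => ((T u : X) : V) := by fun_prop
        have := (h3.tendsto b).comp hlb
        refine this.congr (fun n => ?_)
        simp)
    have l3 := tendsto_nhds_unique (l1.congr (fun n => by
      have : F (u + (m (ψ n) u : X)) = F (u + (ε (φ (ψ n)) * l u) • e) := by
        rw [← hBu, ← hSF]
        simp [m]
      rw [this])) l2
    rw [← l3, map_smul, smul_eq_mul]; ring
  by_cases hα : α = 0
  · left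
    refine hF.kill X hX b.toLinearMap ?_ (fun u hu => ?_)
    · intro hb
      have hb : b = 0 := by ext u; exact congrArg Subtype.val (LinearMap.congr_fun hb u)
      exact hz (by rw [hα, hb]; rfl)
    · have := key u hu
      rw [hα, zero_mul] at this
      exact this.symm
  · right
    refine ⟨α⁻¹ • b.toLinearMap, fun u hu => ?_⟩
    have := key u hu
    rw [LinearMap.smul_apply, Submodule.coe_smul, map_smul, smul_eq_mul]
    change _ = α⁻¹ * fderiv ℝ F u (b u : X)
    rw [← this]; field_simp
end

section
variable {V W : Type*} [NormedAddCommGroup V] [NormedSpace ℝ V]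
variable {F : V → ℝ}

lemma HypF.quadW (hF : HypF F) (X : Submodule ℝ V)
    (hX : Module.finrank ℝ X = 2) (β : Module.Basis (Fin 2) ℝ X) (p q r : X)
    (H : ∀ u : X, u ≠ 0 → fderiv ℝ F u
      ((β.repr u 0 ^ 2) • p + (β.repr u 0 * β.repr u 1) • q + (β.repr u 1 ^ 2) • r : X) = 0) :
    Euc F X ∨ (p = 0 ∧ q = 0 ∧ r = 0) := by
  have hsum : ∀ u : X, u = β.repr u 0 • β 0 + β.repr u 1 • β 1 := fun u => by
    have h := β.sum_repr u
    rw [Fin.sum_univ_two] at h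
    exact h.symm
  have hr0 : ∀ x y : ℝ, β.repr (x • β 0 + y • β 1) 0 = x := by intro x y; simp
  have hr1 : ∀ x y : ℝ, β.repr (x • β 0 + y • β 1) 1 = y := by intro x y; simp
  let w : ℝ → ℝ → X := fun x y => (x ^ 2) • p + (x * y) • q + (y ^ 2) • r
  obtain ⟨x0, y0, hn, hw0⟩ : ∃ x0 y0 : ℝ, x0 ^ 2 + y0 ^ 2 = 1 ∧ w x0 y0 = 0 := by
    let g : ℝ → ℝ := fun θ => Real.cos θ * β.repr (w (Real.cos θ) (Real.sin θ)) 1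
      - Real.sin θ * β.repr (w (Real.cos θ) (Real.sin θ)) 0
    have hg : Continuous g := by
      simp only [g, w, map_add, map_smul, Finsupp.add_apply, Finsupp.smul_apply]
      fun_prop
    have g0 : g 0 = β.repr p 1 := by simp [g, w]
    have g1 : g Real.pi = - β.repr p 1 := by simp [g, w]
    have hz : (0:ℝ) ∈ g '' (uIcc 0 Real.pi) := by
      apply intermediate_value_uIcc hg.continuousOn
      rw [g0, g1, mem_uIcc]
      rcases le_total 0 (β.repr p 1) with h | h
      · right; constructor <;> linarith
      · left; constructor <;> linarith
    obtain ⟨θ, -, hθ⟩ := hz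
    have hn := Real.cos_sq_add_sin_sq θ
    simp only [g] at hθ
    generalize Real.cos θ = x0 at *
    generalize Real.sin θ = y0 at *
    refine ⟨x0, y0, hn, ?_⟩
    set us : X := x0 • β 0 + y0 • β 1 with hus
    have hus0 : us ≠ 0 := by
      intro h
      have h0 := hr0 x0 y0
      have h1 := hr1 x0 y0
      rw [← hus, h] at h0 h1
      simp at h0 h1
      rw [← h0, ← h1] at hn; norm_num at hn
    have hH := H us hus0
    rw [hus, hr0, hr1, ← hus] at hH
    change fderiv ℝ F us (w x0 y0) = 0 at hH
    obtain ⟨μ, hμ⟩ : ∃ μ : ℝ, w x0 y0 = μ • us := by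
      refine ⟨x0 * β.repr (w x0 y0) 0 + y0 * β.repr (w x0 y0) 1, ?_⟩
      conv_lhs => rw [hsum (w x0 y0)]
      generalize β.repr (w x0 y0) 0 = A at *
      generalize β.repr (w x0 y0) 1 = B at *
      rw [hus, smul_add, smul_smul, smul_smul]
      congr 2
      · linear_combination (-A) * hn + (-y0) * hθ
      · linear_combination (-B) * hn + (x0) * hθ
    have hus0' : (us : V) ≠ 0 := by simpa using hus0
    rw [hμ, Submodule.coe_smul, map_smul, hF.e0 _ hus0', smul_eq_mul] at hH
    have := hF.pos _ hus0'
    rcases mul_eq_zero.1 hH with h | h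
    · rw [hμ, h, zero_smul]
    · linarith
  obtain ⟨P, R, hPR⟩ : ∃ P R : X, ∀ x y : ℝ, w x y = (y0 * x - x0 * y) • (x • P + y • R) := by
    by_cases hy : y0 = 0
    · subst hy
      have hx : x0 ^ 2 = 1 := by linarith
      have hp : p = 0 := by
        simpa [w, hx] using hw0
      refine ⟨-x0 • q, -x0 • r, fun x y => ?_⟩
      simp only [w, hp]
      have e1 : x * y = (0 * x - x0 * y) * (x * -x0) := by linear_combination (-x * y) * hx
      have e2 : y ^ 2 = (0 * x - x0 * y) * (y * -x0) := by linear_combination (-y^2) * hx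
      rw [smul_zero, zero_add, e1, e2]
      module
    · have hr : r = (-(x0 ^ 2 / y0 ^ 2)) • p + (-(x0 / y0)) • q := by
        have h1 : y0 ^ 2 • r = (-x0 ^ 2) • p + (-(x0 * y0)) • q := by
          have : (x0 ^ 2) • p + (x0 * y0) • q + (y0 ^ 2) • r = 0 := hw0
          rw [← sub_eq_zero, ← this]; module
        have h2 : r = (y0 ^ 2)⁻¹ • (y0 ^ 2 • r) := by
          rw [smul_smul, inv_mul_cancel₀ (by positivity), one_smul]
        rw [h2, h1, smul_add, smul_smul, smul_smul]
        congr 2 <;> field_simp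
      refine ⟨(1 / y0) • p, (x0 / y0 ^ 2) • p + (1 / y0) • q, fun x y => ?_⟩
      simp only [w]
      rw [hr]
      match_scalars <;> field_simp <;> ring
  let L : X →ₗ[ℝ] X := (β.coord 0).smulRight P + (β.coord 1).smulRight R
  have hLu : ∀ u, L u = β.repr u 0 • P + β.repr u 1 • R := fun u => by simp [L]
  by_cases hL : L = 0
  · right
    have hP : P = 0 := by
      have := hLu (β 0); rw [hL] at this; simpa using this.symm
    have hR : R = 0 := by
      have := hLu (β 1); rw [hL] at this; simpa using this.symm
    have hw : ∀ x y, w x y = 0 := by intro x y; rw [hPR, hP, hR]; simp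
    have hp : p = 0 := by simpa [w] using hw 1 0
    have hr : r = 0 := by simpa [w] using hw 0 1
    have hq : q = 0 := by simpa [w, hp, hr] using hw 1 1
    exact ⟨hp, hq, hr⟩
  · left
    have h1 : ∀ u : X, u ≠ 0 → y0 * β.repr u 0 - x0 * β.repr u 1 ≠ 0 →
        fderiv ℝ F u (L u : X) = 0 := by
      intro u hu h
      have := H u hu
      change fderiv ℝ F u (w (β.repr u 0) (β.repr u 1)) = 0 at this
      rw [hPR, ← hLu, Submodule.coe_smul, map_smul, smul_eq_mul] at this
      exact (mul_eq_zero.1 this).resolve_left h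
    refine hF.kill X hX L hL (fun u hu => ?_)
    by_cases h : y0 * β.repr u 0 - x0 * β.repr u 1 = 0
    swap
    · exact h1 u hu h
    let n : X := y0 • β 0 + (-x0) • β 1
    let ut : ℝ → X := fun t => u + t • n
    have hut : ∀ t, y0 * β.repr (ut t) 0 - x0 * β.repr (ut t) 1 = t := by
      intro t
      have e0 : β.repr (ut t) 0 = β.repr u 0 + t * y0 := by
        simp only [ut, n, map_add, map_smul, Finsupp.add_apply, Finsupp.smul_apply]; simp
      have e1 : β.repr (ut t) 1 = β.repr u 1 + t * (-x0) := by
        simp only [ut, n, map_add, map_smul, Finsupp.add_apply, Finsupp.smul_apply]; simp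
      rw [e0, e1]
      linear_combination h + t * hn
    have hu' : (u : V) ≠ 0 := by simpa using hu
    have hc1 : ContinuousAt (fun t : ℝ => (ut t : V)) 0 := by
      simp only [ut]; push_cast; fun_prop
    have hc2 : ContinuousAt (fun t : ℝ => ((L (ut t) : X) : V)) 0 := by
      simp only [ut, map_add, map_smul]; push_cast; fun_prop
    have hc3 : ContinuousAt (fun t : ℝ => fderiv ℝ F (ut t)) 0 := by
      apply ContinuousAt.comp (f := fun t : ℝ => (ut t : V)) _ hc1
      simpa [ut] using (hF.d1 u hu').continuousAt
    have hc4 : ContinuousAt (fun t : ℝ => fderiv ℝ F (ut t) (L (ut t) : X)) 0 := hc3.clm_apply hc2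
    have l1 : Tendsto (fun t : ℝ => fderiv ℝ F (ut t) (L (ut t) : X)) (𝓝[≠] 0)
        (𝓝 (fderiv ℝ F u (L u : X))) := by
      have := hc4.tendsto
      simp only [show ut 0 = u by simp [ut]] at this
      exact this.mono_left nhdsWithin_le_nhds
    have l2 : Tendsto (fun t : ℝ => fderiv ℝ F (ut t) (L (ut t) : X)) (𝓝[≠] 0) (𝓝 0) := by
      refine tendsto_const_nhds.congr' ?_
      filter_upwards [self_mem_nhdsWithin] with t ht
      refine (h1 (ut t) ?_ ?_).symm
      · intro h0
        have := hut t
        rw [h0] at this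
        simp at this
        exact ht this.symm
      · rw [hut]; exact ht
    exact tendsto_nhds_unique l1 l2

lemma HypF.shadow (hF : HypF F) (X : Submodule ℝ V)
    (hX : Module.finrank ℝ X = 2) (e : V)
    (hb : ∀ l : X →ₗ[ℝ] ℝ, ∃ b : X →ₗ[ℝ] X, ∀ u : X, u ≠ 0 →
      l u * fderiv ℝ F u e = fderiv ℝ F u (b u : X)) :
    Euc F X ∨ ∃ c : X, ∀ u : X, u ≠ 0 → fderiv ℝ F u e = fderiv ℝ F u c := by
  have : FiniteDimensional ℝ X := Module.finite_of_finrank_pos (by omega)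
  let β := Module.finBasisOfFinrankEq ℝ X hX
  have hsum : ∀ u : X, u = β.repr u 0 • β 0 + β.repr u 1 • β 1 := fun u => by
    have h := β.sum_repr u
    rw [Fin.sum_univ_two] at h
    exact h.symm
  obtain ⟨b1, h1⟩ := hb (β.coord 0)
  obtain ⟨b2, h2⟩ := hb (β.coord 1)
  simp only [Module.Basis.coord_apply] at h1 h2
  rcases hF.quadW X hX β (-b2 (β 0)) (b1 (β 0) - b2 (β 1)) (b1 (β 1)) (fun u hu => by
    have e1 := h1 u hu
    have e2 := h2 u hu
    have : (β.repr u 0 ^ 2) • -b2 (β 0) + (β.repr u 0 * β.repr u 1) • (b1 (β 0) - b2 (β 1))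
        + (β.repr u 1 ^ 2) • b1 (β 1) = β.repr u 1 • b1 u - β.repr u 0 • b2 u := by
      have a1 : b1 u = β.repr u 0 • b1 (β 0) + β.repr u 1 • b1 (β 1) := by
        conv_lhs => rw [hsum u, map_add, map_smul, map_smul]
      have a2 : b2 u = β.repr u 0 • b2 (β 0) + β.repr u 1 • b2 (β 1) := by
        conv_lhs => rw [hsum u, map_add, map_smul, map_smul]
      rw [a1, a2]; module
    rw [this]
    push_cast
    rw [map_sub, map_smul, map_smul, ← e1, ← e2, smul_eq_mul, smul_eq_mul]
    ring) with h | ⟨hp, hq, hr⟩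
  · exact Or.inl h
  · right
    refine ⟨b1 (β 0), fun u hu => ?_⟩
    have hq : b2 (β 1) = b1 (β 0) := (sub_eq_zero.1 hq).symm
    have hp : b2 (β 0) = 0 := neg_eq_zero.1 hp
    have a1 : b1 u = β.repr u 0 • b1 (β 0) := by
      conv_lhs => rw [hsum u, map_add, map_smul, map_smul, hr, smul_zero, add_zero]
    have a2 : b2 u = β.repr u 1 • b1 (β 0) := by
      conv_lhs => rw [hsum u, map_add, map_smul, map_smul, hp, smul_zero, zero_add, hq]
    have e1 := h1 u hu
    have e2 := h2 u hu
    rw [a1, Submodule.coe_smul, map_smul, smul_eq_mul] at e1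
    rw [a2, Submodule.coe_smul, map_smul, smul_eq_mul] at e2
    by_cases h0 : β.repr u 0 = 0
    · by_cases h3 : β.repr u 1 = 0
      · exact absurd (by rw [hsum u, h0, h3]; simp) hu
      · exact mul_left_cancel₀ h3 e2
    · exact mul_left_cancel₀ h0 e1
end

section
variable {V W : Type*} [NormedAddCommGroup V] [NormedSpace ℝ V]
  [NormedAddCommGroup W] [NormedSpace ℝ W]
variable {F : V → ℝ}

lemma deriv_line (g : V → W) (u x : V) (t : ℝ) (hg : DifferentiableAt ℝ g (u + t • x)) :
    HasDerivAt (fun t : ℝ => g (u + t • x)) (fderiv ℝ g (u + t • x) x) t := by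
  have h : HasDerivAt (fun t : ℝ => u + t • x) x t := by
    simpa using ((hasDerivAt_id t).smul_const x).const_add u
  exact hg.hasFDerivAt.comp_hasDerivAt t h

lemma HypF.c3_euc (hF : HypF F) (X : Submodule ℝ V) (hE : Euc F X) (u x : V) (hu : u ∈ X)
    (hx : x ∈ X) (h0 : ∀ t : ℝ, u + t • x ≠ 0) :
    fderiv ℝ (fderiv ℝ (fderiv ℝ F)) u x x x = 0 := by
  obtain ⟨α, β, γ, h⟩ := hE u hu x hx
  have h1 : ∀ t : ℝ, fderiv ℝ F (u + t • x) x = β + 2 * γ * t := by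
    intro t
    have a := deriv_line F u x t (hF.d0 _ (h0 t))
    simp only [h] at a
    have b : HasDerivAt (fun t : ℝ => α + β * t + γ * t ^ 2) (β + 2 * γ * t) t := by
      have := (((hasDerivAt_id t).const_mul β).const_add α).add ((hasDerivAt_pow 2 t).const_mul γ)
      refine this.congr_deriv ?_
      simp; ring
    exact a.unique b
  have h2 : ∀ t : ℝ, fderiv ℝ (fderiv ℝ F) (u + t • x) x x = 2 * γ := by
    intro t
    have a := (deriv_line (fderiv ℝ F) u x t (hF.d1 _ (h0 t))).clm_apply (hasDerivAt_const t x)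
    simp only [h1] at a
    have b : HasDerivAt (fun t : ℝ => β + 2 * γ * t) (2 * γ) t := by
      simpa using ((hasDerivAt_id t).const_mul (2 * γ)).const_add β
    simpa using a.unique b
  have a := ((deriv_line (fderiv ℝ (fderiv ℝ F)) u x 0 (hF.d2 _ (h0 0))).clm_apply
    (hasDerivAt_const 0 x)).clm_apply (hasDerivAt_const 0 x)
  simp only [h2] at a
  simpa using a.unique (hasDerivAt_const 0 (2 * γ))

lemma HypF.c3_sh (hF : HypF F) (u x d : V) 
    (h0 : ∀ t : ℝ, u + t • x ≠ 0) (h1 : ∀ t : ℝ, fderiv ℝ F (u + t • x) d = 0) :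
    fderiv ℝ (fderiv ℝ F) u u d = 0 ∧ fderiv ℝ (fderiv ℝ F) u x d = 0 ∧
    fderiv ℝ (fderiv ℝ (fderiv ℝ F)) u x x d = 0 := by
  have h2 : ∀ t : ℝ, fderiv ℝ (fderiv ℝ F) (u + t • x) x d = 0 := by
    intro t
    have a := (deriv_line (fderiv ℝ F) u x t (hF.d1 _ (h0 t))).clm_apply (hasDerivAt_const t d)
    simp only [h1] at a
    simpa using a.unique (hasDerivAt_const t 0)
  have a := ((deriv_line (fderiv ℝ (fderiv ℝ F)) u x 0 (hF.d2 _ (h0 0))).clm_apply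
    (hasDerivAt_const 0 x)).clm_apply (hasDerivAt_const 0 d)
  simp only [h2] at a
  have hu : u ≠ 0 := by simpa using h0 0
  refine ⟨?_, by simpa using h2 0, by simpa using a.unique (hasDerivAt_const 0 0)⟩
  rw [hF.e1 u hu]
  simpa using h1 0

lemma cubic_zero (C : V →L[ℝ] V →L[ℝ] V →L[ℝ] ℝ) (s1 : ∀ x y z, C x y z = C y x z)
    (s2 : ∀ x y z, C x y z = C x z y) (h : ∀ z, C z z z = 0) : C = 0 := by
  ext x y z
  have a := h (x + y + z)
  have b1 := h (x + y)
  have b2 := h (y + z)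
  have b3 := h (x + z)
  simp only [map_add, add_apply, h] at a b1 b2 b3
  have := s1 x y z
  have := s1 x z y
  have := s1 y z x
  have := s2 x y z
  have := s2 y x z
  have := s2 z x y
  have := s1 x y x
  have := s1 x y y
  have := s2 x x y
  have := s2 x y x
  have := s2 y x y
  have := s1 x z x
  have := s1 x z z
  have := s2 x x z
  have := s2 x z x
  have := s2 z x z
  have := s1 z y z
  have := s1 z y y
  have := s2 z z y
  have := s2 z y z
  have := s2 y z y
  simp only [zero_apply]
  linarith

lemma analytic_zero (f : V → ℝ) (hf : ContDiff ℝ ω f) (x0 : V) (h : ∀ᶠ x in 𝓝 x0, f x = 0) (x : V) :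
    f x = 0 := by
  have h1 : AnalyticOnNhd ℝ f univ := fun y _ => hf.contDiffAt.analyticAt
  have := h1.eqOn_zero_of_preconnected_of_eventuallyEq_zero isPreconnected_univ (mem_univ x0) h
  exact this (mem_univ x)

lemma c3_zero_of_euc (C : V →L[ℝ] V →L[ℝ] V →L[ℝ] ℝ) (s1 : ∀ x y z, C x y z = C y x z)
    (s2 : ∀ x y z, C x y z = C x z y) (x0 : V) (h : ∀ᶠ x in 𝓝 x0, C x x x = 0) : C = 0 :=
  cubic_zero C s1 s2 (analytic_zero (fun x => C x x x) (by fun_prop) x0 h)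

lemma c3_zero_of_sh [FiniteDimensional ℝ V] (hdim : 3 ≤ Module.finrank ℝ V)
    (C : V →L[ℝ] V →L[ℝ] V →L[ℝ] ℝ) (s1 : ∀ x y z, C x y z = C y x z)
    (s2 : ∀ x y z, C x y z = C x z y) (g : V →L[ℝ] V →L[ℝ] ℝ) (gs : ∀ x y, g x y = g y x)
    (gp : ∀ x, x ≠ 0 → 0 < g x x) (u : V) (hu : u ≠ 0) (hCu : C u = 0) (x0 : V)
    (h : ∀ᶠ x in 𝓝 x0, ∀ e, ∃ α β : ℝ, g u (e - (α • u + β • x)) = 0 ∧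
      g x (e - (α • u + β • x)) = 0 ∧ C x x (e - (α • u + β • x)) = 0) : C = 0 := by
  apply cubic_zero C s1 s2
  let k : V → V → ℝ := fun x y => g u u * g x y - g u x * g u y
  have hguu := gp u hu
  have hCu1 : ∀ y z, C u y z = 0 := by intro y z; rw [hCu]; simp
  have hCu2 : ∀ y z, C y u z = 0 := by intro y z; rw [s1, hCu1]
  have hCu3 : ∀ y z, C y z u = 0 := by intro y z; rw [s2, hCu2]
  have main : ∀ x e, C x x e * k x x - k e x * C x x x = 0 := by
    intro x e
    refine analytic_zero (fun x => C x x e * k x x - k e x * C x x x) ?_ x0 ?_ x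
    · simp only [k]; fun_prop
    · filter_upwards [h] with x hx
      obtain ⟨α, β, h1, h2, h3⟩ := hx e
      simp only [map_sub, map_add, map_smul, smul_eq_mul, hCu3] at h1 h2 h3
      have h4 : C x x e = β * C x x x := by linarith
      have h5 : k e x = β * k x x := by
        simp only [k]
        have q1 := gs x u
        have q2 := gs x e
        rw [← q2]
        linear_combination (g u u) * h2 - g u x * h1 + α * g u u * q1
      rw [h4, h5]; ring
  have ortho : ∀ x e, k e x = 0 → k x x ≠ 0 → C x x e = 0 := by
    intro x e h1 h2
    have := main x e
    rw [h1, zero_mul, sub_zero] at this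
    exact (mul_eq_zero.1 this).resolve_right h2
  have kpos : ∀ x, (∀ a : ℝ, x ≠ a • u) → 0 < k x x := by
    intro x hx
    have h1 : x - (g u x / g u u) • u ≠ 0 := fun h => hx _ (sub_eq_zero.1 h)
    have h2 := gp _ h1
    simp only [map_sub, map_smul, sub_apply, smul_apply, smul_eq_mul] at h2
    have h3 := mul_pos hguu h2
    rw [gs x u] at h3
    refine lt_of_lt_of_eq h3 ?_
    simp only [k]; field_simp; ring
  intro z
  by_cases hz : ∃ a : ℝ, z = a • u
  · obtain ⟨a, rfl⟩ := hz
    simp [hCu1]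
  push Not at hz
  have hkz := kpos z hz
  obtain ⟨y', hy'⟩ : ∃ y', y' ∉ Submodule.span ℝ {u, z} := by
    by_contra! hall
    have h1 : Submodule.span ℝ {u, z} = ⊤ := by
      rw [eq_top_iff]; intro y _; exact hall y
    have h2 : Module.finrank ℝ (Submodule.span ℝ ({u, z} : Set V)) ≤ 2 := by
      classical
      have := finrank_span_finset_le_card (R := ℝ) ({u, z} : Finset V)
      rw [Set.finrank, Finset.coe_pair] at this
      exact this.trans (Finset.card_le_two)
    rw [h1, finrank_top] at h2
    omega
  let y1 : V := y' - (k z y' / k z z) • z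
  have hy1 : ∀ a : ℝ, y1 ≠ a • u := by
    intro a h
    apply hy'
    rw [Submodule.mem_span_pair]
    refine ⟨a, k z y' / k z z, ?_⟩
    rw [← h]; simp [y1]
  have hky1 := kpos y1 hy1
  have kadd : ∀ a b c, k (a + b) c = k a c + k b c := by intro a b c; simp [k]; ring
  have ksm : ∀ (r : ℝ) a b, k (r • a) b = r * k a b := by intro a b c; simp [k]; ring
  have ksym : ∀ a b, k a b = k b a := by intro a b; simp only [k]; rw [gs a b]; ring
  have hzy1 : k z y1 = 0 := by
    have : k z y1 = k z y' - k z y' / k z z * k z z := by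
      simp only [y1]
      rw [sub_eq_add_neg, ← neg_smul, ksym, kadd, ksm, ksym y' z]; ring
    rw [this]; field_simp; ring
  let s := √(k z z / k y1 y1)
  have hs : s ^ 2 = k z z / k y1 y1 := Real.sq_sqrt (by positivity)
  let y := s • y1
  have hzy : k z y = 0 := by rw [ksym, ksm, ksym, hzy1, mul_zero]
  have hyz : k y z = 0 := by rw [ksym, hzy]
  have hyy : k y y = k z z := by
    have : k y y = s ^ 2 * k y1 y1 := by rw [ksm, ksym, ksm]; ring
    rw [this, hs]; field_simp
  have c1 : C z z y = 0 := ortho z y hyz hkz.ne'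
  have c2 : C y y z = 0 := ortho y z hzy (by rw [hyy]; exact hkz.ne')
  have kn : ∀ a b, k a (-b) = - k a b := by intro a b; rw [ksym, ← neg_one_smul ℝ b, ksm, ksym]; ring
  have kadd' : ∀ a b c, k c (a + b) = k c a + k c b := by intro a b c; rw [ksym, kadd, ksym a, ksym b]
  have kn' : ∀ a b, k (-a) b = - k a b := by intro a b; rw [ksym, kn, ksym]
  have c3 : C (z + y) (z + y) (z + -y) = 0 := by
    apply ortho
    · simp only [kadd, kadd', kn, kn', hzy, hyz, hyy]; ring
    · simp only [kadd, kadd', kn, kn', hzy, hyz, hyy]; linarith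
  have c4 : C (z + -y) (z + -y) (z + y) = 0 := by
    apply ortho
    · simp only [kadd, kadd', kn, kn', hzy, hyz, hyy]; ring
    · simp only [kadd, kadd', kn, kn', hzy, hyz, hyy]; linarith
  have p1 : C z y z = 0 := by rw [s2, c1]
  have p2 : C y z z = 0 := by rw [s1, p1]
  have p3 : C y z y = 0 := by rw [s2, c2]
  have p4 : C z y y = 0 := by rw [s1, p3]
  simp only [map_add, map_neg, add_apply, neg_apply, c1, c2, p1, p2, p3, p4] at c3 c4
  linarith
end

section
variable {V : Type*} [NormedAddCommGroup V] [NormedSpace ℝ V]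

lemma IsBanachMinkowski.hypF {Φ : V → ℝ} (h : IsBanachMinkowski Φ) : HypF (fun u => Φ u ^ 2) where
  pos v hv := pow_pos (h.2.1 v hv) 2
  hom t ht v := by rw [h.2.2.1 t ht v]; ring
  smooth v hv := (h.2.2.2.2.1.contDiffAt (isOpen_compl_singleton.mem_nhds hv)).pow 2

lemma exists_B {Φ : V → ℝ} {P : Set (V × V)} (hPopen : IsOpen P)
    (hiso : ∀ p ∈ P, ∀ p' ∈ P,
      ∃ A : (Submodule.span ℝ {p.1, p.2} : Submodule ℝ V) ≃ₗ[ℝ]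
            (Submodule.span ℝ {p'.1, p'.2} : Submodule ℝ V),
        ∀ u : (Submodule.span ℝ {p.1, p.2} : Submodule ℝ V),
          Φ ((A u : Submodule.span ℝ {p'.1, p'.2}) : V) = Φ (u : V))
    (p : V × V) (hp : p ∈ P) (e : V) (l : (Submodule.span ℝ {p.1, p.2} : Submodule ℝ V) →ₗ[ℝ] ℝ) :
    ∀ᶠ ε in 𝓝[>] (0:ℝ), ∃ B : (Submodule.span ℝ {p.1, p.2} : Submodule ℝ V) →ₗ[ℝ]
      (Submodule.span ℝ {p.1, p.2} : Submodule ℝ V), ∀ u,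
      (fun u => Φ u ^ 2) (B u : V) = (fun u => Φ u ^ 2) ((u : V) + (ε * l u) • e) := by
  have m1 : p.1 ∈ Submodule.span ℝ {p.1, p.2} := Submodule.subset_span (by simp)
  have m2 : p.2 ∈ Submodule.span ℝ {p.1, p.2} := Submodule.subset_span (by simp)
  let f : ℝ → V × V := fun ε => (p.1 + (ε * l ⟨p.1, m1⟩) • e, p.2 + (ε * l ⟨p.2, m2⟩) • e)
  have hf : Continuous f := by fun_prop
  have hev : ∀ᶠ ε in 𝓝 (0:ℝ), f ε ∈ P := by
    apply hf.continuousAt.eventually_mem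
    apply hPopen.mem_nhds
    simpa [f] using hp
  filter_upwards [hev.filter_mono nhdsWithin_le_nhds] with ε hε
  obtain ⟨A, hA⟩ := hiso p hp (f ε) hε
  let T0 : (Submodule.span ℝ {p.1, p.2} : Submodule ℝ V) →ₗ[ℝ] V :=
    (Submodule.span ℝ {p.1, p.2}).subtype + ε • l.smulRight e
  have hT0 : ∀ u, T0 u = (u : V) + (ε * l u) • e := by
    intro u; simp [T0, smul_smul]
  have hT : ∀ u, T0 u ∈ Submodule.span ℝ {(f ε).1, (f ε).2} := by
    intro u
    obtain ⟨a, b, hab⟩ := Submodule.mem_span_pair.1 u.2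
    rw [Submodule.mem_span_pair]
    refine ⟨a, b, ?_⟩
    have hu : u = a • ⟨p.1, m1⟩ + b • ⟨p.2, m2⟩ := by ext; simp [hab]
    have e1 : (f ε).1 = T0 ⟨p.1, m1⟩ := by rw [hT0]
    have e2 : (f ε).2 = T0 ⟨p.2, m2⟩ := by rw [hT0]
    rw [e1, e2, ← map_smul, ← map_smul, ← map_add, ← hu]
  refine ⟨A.symm.toLinearMap ∘ₗ T0.codRestrict _ hT, fun u => ?_⟩
  have := hA (A.symm (T0.codRestrict _ hT u))
  rw [A.apply_symm_apply] at this
  simp only [LinearMap.codRestrict_apply, hT0] at this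
  simp only [this]
  rfl

lemma euc_transfer {Φ : V → ℝ} (X Y : Submodule ℝ V) (A : Y ≃ₗ[ℝ] X)
    (hA : ∀ u, Φ (A u : V) = Φ u) (h : Euc (fun u => Φ u ^ 2) X) : Euc (fun u => Φ u ^ 2) Y := by
  intro u hu x hx
  obtain ⟨α, β, γ, h1⟩ := h (A ⟨u, hu⟩) (A ⟨u, hu⟩).2 (A ⟨x, hx⟩) (A ⟨x, hx⟩).2
  refine ⟨α, β, γ, fun t => ?_⟩
  rw [← h1 t]
  have := hA (⟨u, hu⟩ + t • ⟨x, hx⟩)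
  rw [map_add, map_smul] at this
  push_cast at this
  simp only [this]

lemma d3_zero [FiniteDimensional ℝ V] (hdim : 3 ≤ Module.finrank ℝ V)
    {F : V → ℝ} (hF : HypF F) (hconv : ∀ v, v ≠ 0 → ∀ w, w ≠ 0 → 0 < fderiv ℝ (fderiv ℝ F) v w w)
    {P : Set (V × V)} (hPopen : IsOpen P)
    (hPind : ∀ p ∈ P, LinearIndependent ℝ ![p.1, p.2])
    (hcase : (∀ p ∈ P, Euc F (Submodule.span ℝ {p.1, p.2})) ∨
      (∀ p ∈ P, ∀ e, ∃ c ∈ Submodule.span ℝ {p.1, p.2}, ∀ u ∈ Submodule.span ℝ {p.1, p.2}, u ≠ 0 →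
        fderiv ℝ F u e = fderiv ℝ F u c))
    (p : V × V) (hp : p ∈ P) (a b : ℝ) (hab : (a, b) ≠ (0 : ℝ × ℝ)) :
    fderiv ℝ (fderiv ℝ (fderiv ℝ F)) (a • p.1 + b • p.2) = 0 := by
  obtain ⟨v, w⟩ := p
  simp only
  set u := a • v + b • w with hu
  have hD : 0 < a ^ 2 + b ^ 2 := by
    by_cases ha : a = 0
    · have hb : b ≠ 0 := fun hb => hab (by rw [ha, hb]; rfl)
      positivity
    · positivity
  have h00 : ∀ t : ℝ, a - t * b = 0 → b + t * a = 0 → False := by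
    intro t h1 h2
    have : a = t * b := by linarith
    have hb : b * (1 + t ^ 2) = 0 := by rw [this] at h2; linarith
    have hb : b = 0 := (mul_eq_zero.1 hb).resolve_right (by positivity)
    rw [this, hb] at hD
    norm_num at hD
  let D := a ^ 2 + b ^ 2
  let px : V → V × V := fun x => (D⁻¹ • (a • u - b • x), D⁻¹ • (b • u + a • x))
  let x0 : V := -b • v + a • w
  have hpx : Continuous px := by fun_prop
  have hpx0 : px x0 = (v, w) := by
    have hDD : D⁻¹ * D = 1 := inv_mul_cancel₀ hD.ne'
    simp only [px, hu, x0]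
    refine Prod.ext ?_ ?_
    · have : a • (a • v + b • w) - b • (-b • v + a • w) = D • v := by simp only [D]; module
      simp only [this, smul_smul, hDD, one_smul]
    · have : b • (a • v + b • w) + a • (-b • v + a • w) = D • w := by simp only [D]; module
      simp only [this, smul_smul, hDD, one_smul]
  have hev : ∀ᶠ x in 𝓝 x0, px x ∈ P := by
    apply hpx.continuousAt.eventually_mem
    apply hPopen.mem_nhds
    rw [hpx0]; exact hp
  have hDD : D⁻¹ * D = 1 := inv_mul_cancel₀ hD.ne'
  clear_value u
  have ux : ∀ x, u = a • (px x).1 + b • (px x).2 := by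
    intro x
    have : (D⁻¹ * D) • u = a • (px x).1 + b • (px x).2 := by
      simp only [px, D]; module
    rwa [hDD, one_smul] at this
  have xx : ∀ x, x = (-b) • (px x).1 + a • (px x).2 := by
    intro x
    have : (D⁻¹ * D) • x = (-b) • (px x).1 + a • (px x).2 := by
      simp only [px, D]; module
    rwa [hDD, one_smul] at this
  have m1 : ∀ x, u ∈ Submodule.span ℝ {(px x).1, (px x).2} := fun x =>
    Submodule.mem_span_pair.2 ⟨_, _, (ux x).symm⟩
  have m2 : ∀ x, x ∈ Submodule.span ℝ {(px x).1, (px x).2} := fun x =>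
    Submodule.mem_span_pair.2 ⟨_, _, (xx x).symm⟩
  have n0 : ∀ x, px x ∈ P → ∀ t : ℝ, u + t • x ≠ 0 := by
    intro x hx t h
    have h1 := LinearIndependent.pair_iff.1 (hPind _ hx) (a - t * b) (b + t * a) (by
      rw [← h]
      conv_rhs => rw [ux x]
      conv_rhs => rw [show t • x = t • ((-b) • (px x).1 + a • (px x).2) by rw [← xx x]]
      module)
    exact h00 t h1.1 h1.2
  have hu0 : u ≠ 0 := by
    have := n0 x0 hev.self_of_nhds 0
    simpa using this
  rcases hcase with hE | hS
  · refine c3_zero_of_euc _ (fun x y z => by rw [hF.sym3a u hu0]) (hF.sym3b u hu0) x0 ?_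
    filter_upwards [hev] with x hx
    exact hF.c3_euc _ (hE _ hx) u x (m1 x) (m2 x) (n0 x hx)
  · refine c3_zero_of_sh hdim _ (fun x y z => by rw [hF.sym3a u hu0]) (hF.sym3b u hu0)
      (fderiv ℝ (fderiv ℝ F) u) (hF.sym2 u hu0) (hconv u hu0) u hu0 (hF.e2 u hu0) x0 ?_
    filter_upwards [hev] with x hx
    intro e
    obtain ⟨c, hc, hce⟩ := hS _ hx e
    obtain ⟨m, n, hmn⟩ := Submodule.mem_span_pair.1 hc
    refine ⟨D⁻¹ * (m * a + n * b), D⁻¹ * (-(m * b) + n * a), ?_⟩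
    have hcc : (D⁻¹ * (m * a + n * b)) • u + (D⁻¹ * (-(m * b) + n * a)) • x = c := by
      rw [← hmn]; simp only [px]; module
    rw [hcc]
    refine hF.c3_sh u x (e - c) (n0 x hx) (fun t => ?_)
    rw [map_sub, hce _ (add_mem (m1 x) (Submodule.smul_mem _ _ (m2 x))) (n0 x hx t), sub_self]
end

/-- Theorem 1': if a connected open family of 2-planes (encoded by a
connected open set `P` of linearly independent spanning pairs) has pairwise isometric
sections of a Banach–Minkowski norm `Φ`, then there is a positive definite quadratic
form `Q` with `Φ² = Q` on every plane of the family; in particular `Φ` restricted to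
each such plane is a Euclidean norm. -/
theorem statement1 (V : Type*) [NormedAddCommGroup V] [NormedSpace ℝ V]
    [FiniteDimensional ℝ V] (hdim : 3 ≤ Module.finrank ℝ V)
    (Φ : V → ℝ) (hΦ : IsBanachMinkowski Φ)
    (P : Set (V × V)) (hPne : P.Nonempty) (hPopen : IsOpen P) (hPconn : IsConnected P)
    (hPind : ∀ p ∈ P, LinearIndependent ℝ ![p.1, p.2])
    (hiso : ∀ p ∈ P, ∀ p' ∈ P,
      ∃ A : (Submodule.span ℝ {p.1, p.2} : Submodule ℝ V) ≃ₗ[ℝ]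
            (Submodule.span ℝ {p'.1, p'.2} : Submodule ℝ V),
        ∀ u : (Submodule.span ℝ {p.1, p.2} : Submodule ℝ V),
          Φ ((A u : Submodule.span ℝ {p'.1, p'.2}) : V) = Φ (u : V)) :
    ∃ Q : QuadraticForm ℝ V, Q.PosDef ∧
      ∀ p ∈ P, ∀ u ∈ Submodule.span ℝ {p.1, p.2}, Φ u ^ 2 = Q u := by
  have hF := hΦ.hypF
  set F : V → ℝ := fun u => Φ u ^ 2 with hFdef
  have hconv : ∀ v, v ≠ 0 → ∀ w, w ≠ 0 → 0 < fderiv ℝ (fderiv ℝ F) v w w := by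
    intro v hv w hw
    have := hΦ.2.2.2.2.2 v hv w hw
    rw [iteratedFDeriv_two_apply] at this
    simpa using this
  have hrank : ∀ p ∈ P, Module.finrank ℝ (Submodule.span ℝ {p.1, p.2} : Submodule ℝ V) = 2 := by
    intro p hp
    have := finrank_span_eq_card (hPind p hp)
    have e : Set.range ![p.1, p.2] = {p.1, p.2} := by
      simp only [Matrix.range_cons, Matrix.range_empty, Set.union_empty, Set.singleton_union]
    rw [e] at this
    simpa using this
  have hcase : (∀ p ∈ P, Euc F (Submodule.span ℝ {p.1, p.2})) ∨
      (∀ p ∈ P, ∀ e, ∃ c ∈ Submodule.span ℝ {p.1, p.2}, ∀ u ∈ Submodule.span ℝ {p.1, p.2}, u ≠ 0 →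
        fderiv ℝ F u e = fderiv ℝ F u c) := by
    by_cases hE : ∃ p ∈ P, Euc F (Submodule.span ℝ {p.1, p.2})
    · left
      obtain ⟨p, hp, hE⟩ := hE
      intro p' hp'
      obtain ⟨A, hA⟩ := hiso p' hp' p hp
      exact euc_transfer _ _ A hA hE
    · right
      intro p hp e
      have hnE : ¬ Euc F (Submodule.span ℝ {p.1, p.2}) := fun h => hE ⟨p, hp, h⟩
      have h1 := hF.shadow _ (hrank p hp) e (fun l =>
        (hF.dich _ (hrank p hp) e l (exists_B hPopen hiso p hp e l)).resolve_left hnE)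
      obtain ⟨c, hc⟩ := h1.resolve_left hnE
      exact ⟨c, c.2, fun u hu hu0 => hc ⟨u, hu⟩ (by simpa using hu0)⟩
  have h3 := d3_zero hdim hF hconv hPopen hPind hcase
  let m : (V × V) × (ℝ × ℝ) → V := fun q => q.2.1 • q.1.1 + q.2.2 • q.1.2
  let U : Set V := m '' (P ×ˢ {(0 : ℝ × ℝ)}ᶜ)
  have hUne : ∀ u ∈ U, u ≠ 0 := by
    rintro _ ⟨⟨p, a, b⟩, ⟨hp, hab⟩, rfl⟩ h
    have := LinearIndependent.pair_iff.1 (hPind p hp) a b h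
    exact hab (by rw [mem_singleton_iff, this.1, this.2]; rfl)
  have hUconn : IsPreconnected U := by
    refine ((hPconn.prod ?_).isPreconnected).image m (by fun_prop : Continuous m).continuousOn
    apply isConnected_compl_singleton_of_one_lt_rank
    rw [← Module.finrank_eq_rank]; simp
  have hUopen : IsOpen U := by
    rw [isOpen_iff_mem_nhds]
    rintro _ ⟨⟨⟨v, w⟩, a, b⟩, ⟨hp, hab⟩, rfl⟩
    by_cases ha : a = 0
    · have hb : b ≠ 0 := fun hb => hab (by rw [mem_singleton_iff, ha, hb]; rfl)
      have hc : Continuous fun u' : V => (v, b⁻¹ • (u' - a • v)) := by fun_prop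
      have hev : ∀ᶠ u' in 𝓝 (a • v + b • w), (v, b⁻¹ • (u' - a • v)) ∈ P := by
        apply hc.continuousAt.eventually_mem
        apply hPopen.mem_nhds
        simpa [smul_smul, hb] using hp
      filter_upwards [hev] with u' hu'
      exact ⟨((v, b⁻¹ • (u' - a • v)), (a, b)), ⟨hu', hab⟩, by simp [m, smul_smul, hb]⟩
    · have hc : Continuous fun u' : V => (a⁻¹ • (u' - b • w), w) := by fun_prop
      have hev : ∀ᶠ u' in 𝓝 (a • v + b • w), (a⁻¹ • (u' - b • w), w) ∈ P := by
        apply hc.continuousAt.eventually_mem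
        apply hPopen.mem_nhds
        simpa [smul_smul, ha] using hp
      filter_upwards [hev] with u' hu'
      exact ⟨((a⁻¹ • (u' - b • w), w), (a, b)), ⟨hu', hab⟩, by simp [m, smul_smul, ha]⟩
  have h3U : ∀ u ∈ U, fderiv ℝ (fderiv ℝ (fderiv ℝ F)) u = 0 := by
    rintro _ ⟨⟨p, a, b⟩, ⟨hp, hab⟩, rfl⟩
    exact h3 p hp a b hab
  obtain ⟨p0, hp0⟩ := hPne
  have hv0 : p0.1 ∈ U := ⟨(p0, (1, 0)), ⟨hp0, by simp⟩, by simp [m]⟩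
  set H := fderiv ℝ (fderiv ℝ F) p0.1 with hH
  have hHU : ∀ u ∈ U, fderiv ℝ (fderiv ℝ F) u = H := by
    intro u hu
    exact hUopen.is_const_of_fderiv_eq_zero (𝕜 := ℝ) hUconn
      (fun y hy => (hF.d2 y (hUne y hy)).differentiableWithinAt) (fun y hy => h3U y hy) hu hv0
  let Bl : LinearMap.BilinMap ℝ V ℝ := LinearMap.mk₂ ℝ (fun x y => (1/2 : ℝ) * H x y)
    (by intros; simp; ring) (by intros; simp; ring) (by intros; simp; ring) (by intros; simp; ring)
  have hBl : ∀ x, Bl.toQuadraticMap x = (1/2 : ℝ) * H x x := fun x => rfl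
  refine ⟨Bl.toQuadraticMap, ?_, ?_⟩
  · intro x hx
    rw [hBl]
    have := hconv p0.1 (hUne _ hv0) x hx
    positivity
  · intro p hp u hu
    rw [hBl]
    by_cases hu0 : u = 0
    · subst hu0; simp [hΦ.1]
    obtain ⟨a, b, hab⟩ := Submodule.mem_span_pair.1 hu
    have huU : u ∈ U := ⟨(p, (a, b)), ⟨hp, fun h => by
      simp at h; rw [h.1, h.2] at hab; simp at hab; exact hu0 hab.symm⟩, hab⟩
    rw [← hHU u huU, hF.e1 u hu0, hF.e0 u hu0]
    simp [hFdef]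
end
end
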